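/- arXiv:math/0612794 — 2 statements merged into one kernel-verified Lean document; each statement's English description precedes it below -/
import Mathlib

section
/- (Parameter-dependent Yakubovich Lemma.) Let D be a compact topological space. Let G_{ij} : D → ℂ^{n_z×n_z} be continuous with G_{ij}(p) = (G_{ji}(p))* for all p ∈ D, i, j = 1, …, m; let M, N : D → ℂ^{n×n_z} be continuous; and let Θ₁, Θ₂ : D → HM₂ be continuous with det Θ₁(p) < 0 and det Θ₂(p) < 0 for all p ∈ D. Suppose that for every p ∈ D the intersection Γ_{Θ₁(p)} ∩ Ω_{Θ₂(p)} contains more than one point, and that either (m = 1 and n_z > n) or (m > 1, n_z = n + 1, and rank(αN(p) − βM(p)) = n for every p ∈ D and every nonzero pair (α, β) ∈ ℂ² with (α, β)Θ₁(p)(α, β)* = 0 and (α, β)Θ₂(p)(α, β)* ≥ 0). Let G(p) denote the m·n_z × m·n_z Hermitian block matrix with blocks G_{ij}(p). Then the following are equivalent: (1) for every p ∈ D, every nonzero pair (α, β) ∈ ℂ² with (α, β)Θ₁(p)(α, β)* = 0 and (α, β)Θ₂(p)(α, β)* ≥ 0, and every nonzero z ∈ ℂ^{n_z} with (αN(p)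 − βM(p))z = 0, the m×m Hermitian matrix with (i, j) entry z*G_{ij}(p)z is positive definite; (2) there exist continuous maps H₁, H₂ : D → HM_{mn} such that for all p ∈ D, H₂(p) ≻ 0 and G(p) ≻ Λ'_{I_m⊗M(p), I_m⊗N(p), Θ₁(p)}(H₁(p)) + Λ'_{I_m⊗M(p), I_m⊗N(p), Θ₂(p)}(H₂(p)). -/
open Matrix ComplexOrder

/-- The value `(α, β) Θ (α, β)*` of the Hermitian form defined by a `2 × 2` Hermitian
matrix `Θ` on the row vector `(α, β)`. -/
noncomputable def hermPairVal (Θ : Matrix (Fin 2) (Fin 2) ℂ) (α β : ℂ) : ℂ :=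
  ![α, β] ⬝ᵥ Θ *ᵥ star ![α, β]

/-- The adjoint generalized Lyapunov operator
`Λ'_{M,N,Θ}(H) = θ₁₁ M*HM + θ₂₁ M*HN + θ₁₂ N*HM + θ₂₂ N*HN`. -/
noncomputable def lyapAdj {k z : Type*} [Fintype k] (M N : Matrix k z ℂ)
    (Θ : Matrix (Fin 2) (Fin 2) ℂ) (H : Matrix k k ℂ) : Matrix z z ℂ :=
  Θ 0 0 • (Mᴴ * H * M) + Θ 1 0 • (Mᴴ * H * N) + Θ 0 1 • (Nᴴ * H * M) + Θ 1 1 • (Nᴴ * H * N)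

/-- The Kronecker product `I_m ⊗ M`, a block-diagonal matrix with `m` copies of `M`. -/
noncomputable def idKron {k z : Type*} (m : ℕ) (M : Matrix k z ℂ) :
    Matrix (Fin m × k) (Fin m × z) ℂ :=
  Matrix.kroneckerMap (· * ·) (1 : Matrix (Fin m) (Fin m) ℂ) M

theorem Matrix.IsHermitian.exists_unitary_diagonal {ι : Type*} [Fintype ι] [DecidableEq ι]
    {A : Matrix ι ι ℂ} (hA : A.IsHermitian) :
    ∃ (U : Matrix ι ι ℂ) (d : ι → ℝ), Uᴴ * U = 1 ∧ U * Uᴴ = 1 ∧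
      A = U * diagonal (fun i => (d i : ℂ)) * Uᴴ := by
  refine ⟨hA.eigenvectorUnitary, hA.eigenvalues, ?_, ?_, ?_⟩
  · exact Unitary.coe_star_mul_self hA.eigenvectorUnitary
  · exact Unitary.coe_mul_star_self hA.eigenvectorUnitary
  · conv_lhs => rw [hA.spectral_theorem, Unitary.conjStarAlgAut_apply]
    rfl

/-- A positive semidefinite diagonalised matrix has nonnegative diagonal entries. -/
theorem nonneg_of_posSemidef_unitary_conj {ι : Type*} [Fintype ι] [DecidableEq ι]
    {U : Matrix ι ι ℂ} {d : ι → ℝ} (hU : Uᴴ * U = 1)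
    (h : (U * diagonal (fun i => (d i : ℂ)) * Uᴴ).PosSemidef) (i : ι) : 0 ≤ d i := by
  have h1 := h.conjTranspose_mul_mul_same U
  have h2 : Uᴴ * (U * diagonal (fun i => (d i : ℂ)) * Uᴴ) * U =
      diagonal (fun i => (d i : ℂ)) := by
    have : Uᴴ * (U * diagonal (fun i => (d i : ℂ)) * Uᴴ) * U =
      (Uᴴ * U) * diagonal (fun i => (d i : ℂ)) * (Uᴴ * U) := by simp only [Matrix.mul_assoc]
    rw [this, hU, Matrix.one_mul, Matrix.mul_one]
  rw [h2, posSemidef_diagonal_iff] at h1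
  exact_mod_cast h1 i

theorem unitary_conj_mul {ι : Type*} [Fintype ι] [DecidableEq ι]
    {U : Matrix ι ι ℂ} (hU : Uᴴ * U = 1) (A B : Matrix ι ι ℂ) :
    (U * A * Uᴴ) * (U * B * Uᴴ) = U * (A * B) * Uᴴ := by
  have : (U * A * Uᴴ) * (U * B * Uᴴ) = U * A * (Uᴴ * U) * B * Uᴴ := by
    simp only [Matrix.mul_assoc]
  rw [this, hU]
  simp only [Matrix.mul_assoc, Matrix.one_mul]

theorem Matrix.IsHermitian.unitary_conj_diagonal {ι : Type*} [Fintype ι] [DecidableEq ι]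
    (U : Matrix ι ι ℂ) (d : ι → ℝ) :
    (U * diagonal (fun i => (d i : ℂ)) * Uᴴ).IsHermitian := by
  have : (diagonal (fun i => (d i : ℂ))).IsHermitian := by
    refine isHermitian_diagonal_of_self_adjoint _ ?_
    ext i
    simp
  exact isHermitian_mul_mul_conjTranspose U this

/-- Existence of the Moore–Penrose inverse. -/
theorem exists_moore_penrose {κ ι : Type*} [Fintype κ] [Fintype ι] [DecidableEq ι]
    (B : Matrix κ ι ℂ) :
    ∃ C : Matrix ι κ ℂ, B * C * B = B ∧ C * B * C = C ∧
      (B * C).IsHermitian ∧ (C * B).IsHermitian := by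
  obtain ⟨U, d, hU, -, hd⟩ := (isHermitian_conjTranspose_mul_self B).exists_unitary_diagonal
  set H := Bᴴ * B with hH
  set K := U * diagonal (fun i => (((d i)⁻¹ : ℝ) : ℂ)) * Uᴴ with hK
  have hKh : K.IsHermitian := .unitary_conj_diagonal _ _
  have hHh : H.IsHermitian := isHermitian_conjTranspose_mul_self B
  have hHK : H * K = K * H := by
    rw [hd, hK, unitary_conj_mul hU, unitary_conj_mul hU, diagonal_mul_diagonal,
      diagonal_mul_diagonal]
    simp only [mul_comm]
  have hHKH : H * K * H = H := by
    rw [hd, hK, unitary_conj_mul hU, unitary_conj_mul hU, diagonal_mul_diagonal,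
      diagonal_mul_diagonal]
    congr 3
    ext i
    push_cast
    rw [mul_inv_mul_cancel]
  have hKHK : K * H * K = K := by
    rw [hd, hK, unitary_conj_mul hU, unitary_conj_mul hU, diagonal_mul_diagonal,
      diagonal_mul_diagonal]
    congr 3
    ext i
    push_cast
    simpa using mul_inv_mul_cancel ((d i : ℂ)⁻¹)
  have hBKH : B * (1 - K * H) = 0 := by
    rw [← Matrix.conjTranspose_mul_self_eq_zero, conjTranspose_mul]
    have : (1 - K * H)ᴴ * Bᴴ * (B * (1 - K * H)) = (1 - K * H)ᴴ * (H - H * K * H) := by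
      rw [hH]
      simp only [Matrix.mul_assoc, Matrix.mul_sub, Matrix.mul_one]
    rw [this, hHKH, sub_self, Matrix.mul_zero]
  refine ⟨K * Bᴴ, ?_, ?_, ?_, ?_⟩
  · rw [Matrix.mul_sub, Matrix.mul_one, sub_eq_zero] at hBKH
    conv_rhs => rw [hBKH, hH]
    simp only [Matrix.mul_assoc]
  · have : K * Bᴴ * B * (K * Bᴴ) = K * H * K * Bᴴ := by rw [hH]; simp only [Matrix.mul_assoc]
    rw [this, hKHK]
  · rw [← Matrix.mul_assoc]
    exact isHermitian_mul_mul_conjTranspose B hKh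
  · rw [Matrix.mul_assoc, ← hH, Matrix.IsHermitian, conjTranspose_mul, hKh.eq, hHh.eq, hHK]

theorem one_sub_conjTranspose_mul_self_posSemidef {κ ι : Type*} [Fintype κ] [Fintype ι]
    [DecidableEq κ] [DecidableEq ι] {Z : Matrix κ ι ℂ} (h : (1 - Z * Zᴴ).PosSemidef) :
    (1 - Zᴴ * Z).PosSemidef := by
  let _ : Invertible (1 : Matrix κ κ ℂ) := invertibleOne
  let _ : Invertible (1 : Matrix ι ι ℂ) := invertibleOne
  have h1 := PosDef.fromBlocks₁₁ Z (1 : Matrix ι ι ℂ)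
    (PosDef.one (n := κ) (R := ℂ))
  have h2 := PosDef.fromBlocks₂₂ (1 : Matrix κ κ ℂ) Z
    (PosDef.one (n := ι) (R := ℂ))
  simp only [inv_one, Matrix.mul_one] at h1 h2
  exact h1.1 (h2.2 h)

/-- Douglas' factorisation lemma. -/
theorem exists_contraction_factor {κ ι ι' : Type*} [Fintype κ] [Fintype ι] [Fintype ι']
    [DecidableEq κ] [DecidableEq ι] {A : Matrix κ ι' ℂ} {B : Matrix κ ι ℂ} {C : Matrix ι κ ℂ}
    (h : (B * Bᴴ - A * Aᴴ).PosSemidef) (h1 : B * C * B = B) (h2 : C * B * C = C)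
    (h4 : (C * B).IsHermitian) :
    B * (C * A) = A ∧ (C * B - (C * A) * (C * A)ᴴ).PosSemidef := by
  constructor
  · have hz : (1 - B * C) * A = 0 := by
      rw [← Matrix.self_mul_conjTranspose_eq_zero]
      have hp := h.mul_mul_conjTranspose_same (1 - B * C)
      have hB : (1 - B * C) * B = 0 := by rw [Matrix.sub_mul, h1, Matrix.one_mul, sub_self]
      have he : (1 - B * C) * (B * Bᴴ - A * Aᴴ) * (1 - B * C)ᴴ =
          -((1 - B * C) * A * ((1 - B * C) * A)ᴴ) := by
        rw [Matrix.mul_sub, ← Matrix.mul_assoc, hB, Matrix.zero_mul, zero_sub, Matrix.neg_mul,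
          conjTranspose_mul]
        simp only [Matrix.mul_assoc]
      rw [he] at hp
      have hq := posSemidef_self_mul_conjTranspose ((1 - B * C) * A)
      have ht : trace ((1 - B * C) * A * ((1 - B * C) * A)ᴴ) = 0 := by
        apply le_antisymm _ hq.trace_nonneg
        have := hp.trace_nonneg
        rwa [trace_neg, Left.nonneg_neg_iff] at this
      rw [Matrix.trace_mul_conjTranspose_self_eq_zero_iff] at ht
      rw [ht]; simp
    rw [Matrix.sub_mul, Matrix.one_mul, sub_eq_zero] at hz
    rw [← Matrix.mul_assoc, ← hz]
  · have hp := h.mul_mul_conjTranspose_same C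
    have : C * (B * Bᴴ - A * Aᴴ) * Cᴴ = C * B - (C * A) * (C * A)ᴴ := by
      have e : C * B * (C * B)ᴴ = C * B := by
        rw [h4.eq, ← Matrix.mul_assoc, h2]
      conv_rhs => rw [← e]
      simp only [conjTranspose_mul, Matrix.mul_sub, Matrix.sub_mul, Matrix.mul_assoc]
    rwa [this] at hp

theorem conjTranspose_one_sub_mul_self_of_projection {ι : Type*} [Fintype ι] [DecidableEq ι]
    {P : Matrix ι ι ℂ} (hP : P.IsHermitian) (hPP : P * P = P) :
    (1 - P)ᴴ * (1 - P) = 1 - P := by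
  rw [conjTranspose_sub, conjTranspose_one, hP.eq, Matrix.mul_sub, Matrix.mul_one, Matrix.sub_mul,
    hPP, Matrix.one_mul, sub_self, sub_zero]

theorem posSemidef_one_sub_of_projection {ι : Type*} [Fintype ι] [DecidableEq ι]
    {P : Matrix ι ι ℂ} (hP : P.IsHermitian) (hPP : P * P = P) : (1 - P).PosSemidef := by
  rw [← conjTranspose_one_sub_mul_self_of_projection hP hPP]
  exact posSemidef_conjTranspose_mul_self _

theorem conjTranspose_mul_one_sub_mul {κ ι ι' : Type*} [Fintype κ] [Fintype ι] [DecidableEq ι]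
    (Z : Matrix κ ι ℂ) (R : Matrix ι ι' ℂ) :
    Rᴴ * (1 - Zᴴ * Z) * R = Rᴴ * R - (Z * R)ᴴ * (Z * R) := by
  simp only [Matrix.mul_sub, Matrix.sub_mul, Matrix.mul_one, conjTranspose_mul, Matrix.mul_assoc]

/-- Square root of `1 - A²` commuting with `A`. -/
theorem exists_sqrt_one_sub_sq {ι : Type*} [Fintype ι] [DecidableEq ι]
    {A : Matrix ι ι ℂ} (hA : A.IsHermitian) (h : (1 - A * A).PosSemidef) :
    ∃ J : Matrix ι ι ℂ, J.IsHermitian ∧ A * J = J * A ∧ A * A + J * J = 1 := by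
  obtain ⟨U, d, hU, hU', hd⟩ := hA.exists_unitary_diagonal
  have h1 : 1 - A * A = U * diagonal (fun i => ((1 - d i * d i : ℝ) : ℂ)) * Uᴴ := by
    have e : diagonal (fun i => ((1 - d i * d i : ℝ) : ℂ)) =
        1 - diagonal (fun i => (d i : ℂ)) * diagonal (fun i => (d i : ℂ)) := by
      rw [diagonal_mul_diagonal, ← diagonal_one, diagonal_sub]
      simp
    rw [e, Matrix.mul_sub, Matrix.sub_mul, Matrix.mul_one, hU', ← unitary_conj_mul hU, ← hd]
  have h2 : ∀ i, 0 ≤ 1 - d i * d i := nonneg_of_posSemidef_unitary_conj hU (h1 ▸ h)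
  refine ⟨U * diagonal (fun i => ((√(1 - d i * d i) : ℝ) : ℂ)) * Uᴴ,
    .unitary_conj_diagonal _ _, ?_, ?_⟩
  · rw [hd, unitary_conj_mul hU, unitary_conj_mul hU, diagonal_mul_diagonal,
      diagonal_mul_diagonal]
    simp only [mul_comm]
  · rw [unitary_conj_mul hU, diagonal_mul_diagonal, eq_comm, ← sub_eq_iff_eq_add', h1]
    congr 3
    ext i
    rw [← Complex.ofReal_mul, Real.mul_self_sqrt (h2 i)]

/-- Compressing a self-adjoint unitary by a contraction yields a self-adjoint contraction. -/
theorem posSemidef_one_sub_compression {ι κ : Type*} [Fintype ι] [Fintype κ] [DecidableEq ι]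
    [DecidableEq κ] {V : Matrix κ κ ℂ} (hV : V.IsHermitian) (hVV : V * V = 1)
    {K : Matrix κ ι ℂ} (hK : (1 - Kᴴ * K).PosSemidef) :
    (1 - Kᴴ * V * K).PosSemidef := by
  have h1 : (((1 / 2 : ℝ) : ℂ) • (((1 - V) * K)ᴴ * ((1 - V) * K))).PosSemidef :=
    (posSemidef_conjTranspose_mul_self _).smul (by positivity)
  have h2 := hK.add h1
  have h3 : ((1 - V) * K)ᴴ * ((1 - V) * K) = (2 : ℂ) • (Kᴴ * K - Kᴴ * V * K) := by
    have : (1 - V)ᴴ * (1 - V) = (2 : ℂ) • (1 - V) := by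
      rw [conjTranspose_sub, conjTranspose_one, hV.eq, Matrix.mul_sub, Matrix.sub_mul, two_smul,
        Matrix.sub_mul, hVV, Matrix.mul_one, Matrix.mul_one, Matrix.one_mul]
      abel
    rw [conjTranspose_mul, Matrix.mul_assoc, ← Matrix.mul_assoc _ _ K, this]
    simp only [Matrix.smul_mul, Matrix.mul_smul, Matrix.sub_mul, Matrix.mul_sub, Matrix.one_mul,
      Matrix.mul_assoc]
  rw [h3, smul_smul] at h2
  convert h2 using 1
  norm_num

/-- Krein's extension theorem in matrix form: a symmetric contractive relation between the rows
extends to a self-adjoint contraction. -/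
theorem exists_hermitian_contraction_factor {κ ι : Type*} [Fintype κ] [Fintype ι]
    [DecidableEq κ] [DecidableEq ι] {X Y : Matrix κ ι ℂ} (hXY : X * Yᴴ = Y * Xᴴ)
    (h : (Y * Yᴴ - X * Xᴴ).PosSemidef) :
    ∃ S : Matrix ι ι ℂ, S.IsHermitian ∧ X = Y * S ∧ (1 - S).PosSemidef ∧
      (1 + S).PosSemidef := by
  obtain ⟨T, t1, t2, -, t4⟩ := exists_moore_penrose Y
  obtain ⟨c1, c2⟩ := exists_contraction_factor h t1 t2 t4
  set P := T * Y with hP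
  set C := T * X with hC
  have hPP : P * P = P := by rw [hP, ← Matrix.mul_assoc, t2]
  have hPh : Pᴴ = P := t4.eq
  have hPC : P * C = C := by rw [hP, hC, ← Matrix.mul_assoc, t2]
  have hYP : Y * P = Y := by rw [hP, ← Matrix.mul_assoc, t1]
  have hP1 : (1 - P).PosSemidef := posSemidef_one_sub_of_projection t4 hPP
  have hCC : (1 - C * Cᴴ).PosSemidef := by
    have := hP1.add c2
    rwa [sub_add_sub_cancel] at this
  have hAh : (C * P).IsHermitian := by
    have e : C * P = T * (X * Yᴴ) * Tᴴ := by
      conv_lhs => rw [← hPh, hP, hC, conjTranspose_mul]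
      simp only [Matrix.mul_assoc]
    have : (X * Yᴴ).IsHermitian := by
      rw [Matrix.IsHermitian, conjTranspose_mul, conjTranspose_conjTranspose, hXY]
    rw [e]
    exact isHermitian_mul_mul_conjTranspose T this
  set A := C * P with hA
  set B := C * (1 - P) with hB
  have hAP : A * P = A := by rw [hA, Matrix.mul_assoc, hPP]
  have hPA : P * A = A := by rw [hA, ← Matrix.mul_assoc, hPC]
  have hBP : B * P = 0 := by
    rw [hB, Matrix.mul_assoc, Matrix.sub_mul, hPP, Matrix.one_mul, sub_self, Matrix.mul_zero]
  have hPB : P * B = B := by rw [hB, ← Matrix.mul_assoc, hPC]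
  have hAB : A + B = C := by rw [hA, hB, ← Matrix.mul_add]; simp
  have hCCd : C * Cᴴ = A * A + B * Bᴴ := by
    have e1 : A * A = C * P * Cᴴ := by
      conv_lhs => rw [← hAh.eq, hAh.eq]
      conv_lhs => rhs; rw [← hAh.eq, hA, conjTranspose_mul, hPh]
      rw [← Matrix.mul_assoc, hAP]
    have e2 : B * Bᴴ = C * (1 - P) * Cᴴ := by
      conv_lhs => rhs; rw [hB, conjTranspose_mul, conjTranspose_sub, conjTranspose_one, hPh]
      rw [← Matrix.mul_assoc, Matrix.mul_sub, Matrix.mul_one, hBP, sub_zero]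
    rw [e1, e2, ← Matrix.add_mul, ← Matrix.mul_add]; simp
  obtain ⟨J, hJ, hJA, hJJ⟩ := exists_sqrt_one_sub_sq hAh (by
    have := hCC.add (posSemidef_self_mul_conjTranspose B)
    rw [hCCd] at this
    convert this using 1
    abel)
  obtain ⟨T', s1, s2, -, s4⟩ := exists_moore_penrose J
  obtain ⟨d1, d2⟩ := exists_contraction_factor (A := B) (B := J) (by
    rw [hJ.eq, show J * J - B * Bᴴ = 1 - C * Cᴴ by rw [hCCd, ← hJJ]; abel]
    exact hCC) s1 s2 s4
  set Z := T' * B with hZ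
  have hZP : Z * P = 0 := by rw [hZ, Matrix.mul_assoc, hBP, Matrix.mul_zero]
  have hPZ : P * Zᴴ = 0 := by rw [← hPh, ← conjTranspose_mul, hZP, conjTranspose_zero]
  have hZZ : (1 - Zᴴ * Z).PosSemidef := by
    apply one_sub_conjTranspose_mul_self_posSemidef
    have hQ : (1 - T' * J).PosSemidef :=
      posSemidef_one_sub_of_projection s4 (by rw [← Matrix.mul_assoc, s2])
    have := hQ.add d2
    rwa [sub_add_sub_cancel] at this
  have hK : (1 - (fromRows P Z)ᴴ * fromRows P Z).PosSemidef := by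
    have := hZZ.conjTranspose_mul_mul_same (1 - P)
    have hZ1 : Z * (1 - P) = Z := by rw [Matrix.mul_sub, hZP, Matrix.mul_one, sub_zero]
    have e : (1 - P)ᴴ * (1 - Zᴴ * Z) * (1 - P) = 1 - P - Zᴴ * Z := by
      rw [conjTranspose_mul_one_sub_mul, hZ1, conjTranspose_one_sub_mul_self_of_projection t4 hPP]
    rw [e] at this
    rw [conjTranspose_fromRows_eq_fromCols_conjTranspose, fromCols_mul_fromRows, hPh, hPP]
    rwa [sub_sub] at this
  set V : Matrix (ι ⊕ ι) (ι ⊕ ι) ℂ := fromBlocks A J J (-A) with hV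
  have hVh : V.IsHermitian := by
    rw [hV]
    exact hAh.fromBlocks hJ.eq hAh.neg
  have hVV : V * V = 1 := by
    rw [hV, fromBlocks_multiply, ← fromBlocks_one]
    congr 1
    · rw [hJA]; simp
    · rw [← hJA]; simp
    · rw [← hJJ]; simp [add_comm]
  set K := fromRows P Z with hKdef
  have hS : Kᴴ * V * K = A + B + (Bᴴ - Zᴴ * A * Z) := by
    rw [hKdef, hV, conjTranspose_fromRows_eq_fromCols_conjTranspose, fromCols_mul_fromBlocks,
      fromCols_mul_fromRows, hPh]
    have e1 : P * J * Z = B := by rw [Matrix.mul_assoc, d1, hPB]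
    have e2 : Zᴴ * J * P = Bᴴ := by
      rw [← e1]; simp only [conjTranspose_mul, hPh, hJ.eq, Matrix.mul_assoc]
    rw [Matrix.add_mul, Matrix.add_mul, e1, e2, hPA, hAP]
    simp only [Matrix.mul_neg, Matrix.neg_mul]
    abel
  refine ⟨Kᴴ * V * K, isHermitian_conjTranspose_mul_mul K hVh, ?_,
    posSemidef_one_sub_compression hVh hVV hK, ?_⟩
  · have e : P * (Kᴴ * V * K) = C := by
      have : P * Bᴴ = 0 := by rw [← hPh, ← conjTranspose_mul, hBP, conjTranspose_zero]
      have h' : P * (Zᴴ * A * Z) = 0 := by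
        rw [Matrix.mul_assoc Zᴴ, ← Matrix.mul_assoc P, hPZ, Matrix.zero_mul]
      rw [hS, Matrix.mul_add, Matrix.mul_sub, this, h', hAB, hPC]
      simp
    conv_rhs => rw [← hYP, Matrix.mul_assoc, e, c1]
  · have := posSemidef_one_sub_compression hVh.neg (by simpa using hVV) hK
    simpa using this

theorem exists_hermitian_factor {κ ι : Type*} [Fintype κ] [Fintype ι]
    [DecidableEq κ] [DecidableEq ι] {X Y : Matrix κ ι ℂ} (hXY : X * Yᴴ = Y * Xᴴ)
    (h : ∀ f, Yᴴ *ᵥ f = 0 → Xᴴ *ᵥ f = 0) :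
    ∃ S : Matrix ι ι ℂ, S.IsHermitian ∧ X = Y * S := by
  obtain ⟨T, t1, t2, t3, t4⟩ := exists_moore_penrose Y
  have hYTX : Y * T * X = X := by
    have h0 : Yᴴ * (1 - Y * T) = 0 := by
      have : ((1 - Y * T) * Y)ᴴ = 0 := by
        rw [Matrix.sub_mul, t1, Matrix.one_mul, sub_self, conjTranspose_zero]
      rwa [conjTranspose_mul, conjTranspose_sub, conjTranspose_one, t3.eq] at this
    have h1 : Xᴴ * (1 - Y * T) = 0 := by
      apply Matrix.ext_of_mulVec_single
      intro i
      rw [← mulVec_mulVec, Matrix.zero_mulVec]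
      apply h
      rw [mulVec_mulVec, h0, Matrix.zero_mulVec]
    have h2 : (Xᴴ * (1 - Y * T))ᴴ = 0 := by rw [h1, conjTranspose_zero]
    rw [conjTranspose_mul, conjTranspose_sub, conjTranspose_one, t3.eq,
      conjTranspose_conjTranspose, Matrix.sub_mul, Matrix.one_mul, sub_eq_zero] at h2
    exact h2.symm
  have hYC : Y * (T * X) = X := by rw [← Matrix.mul_assoc, hYTX]
  set P := T * Y with hP
  set C := T * X with hC
  have hPP : P * P = P := by rw [hP, ← Matrix.mul_assoc, t2]
  have hYP : Y * P = Y := by rw [hP, ← Matrix.mul_assoc, t1]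
  have hA : (C * P).IsHermitian := by
    have e : C * P = T * (X * Yᴴ) * Tᴴ := by
      conv_lhs => rw [← t4.eq, hP, hC, conjTranspose_mul]
      simp only [Matrix.mul_assoc]
    have : (X * Yᴴ).IsHermitian := by
      rw [Matrix.IsHermitian, conjTranspose_mul, conjTranspose_conjTranspose, hXY]
    rw [e]
    exact isHermitian_mul_mul_conjTranspose T this
  refine ⟨C * P + (C * (1 - P) + (C * (1 - P))ᴴ), hA.add (isHermitian_add_transpose_self _), ?_⟩
  have h1 : Y * (C * (1 - P))ᴴ = 0 := by
    rw [conjTranspose_mul, conjTranspose_sub, conjTranspose_one, t4.eq, ← Matrix.mul_assoc,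
      Matrix.mul_sub, hYP, Matrix.mul_one, sub_self, Matrix.zero_mul]
  have h2 : C * P + C * (1 - P) = C := by rw [← Matrix.mul_add]; simp
  rw [← add_assoc, Matrix.mul_add, h1, h2, hYC, add_zero]

theorem exists_generic_shift {κ ι : Type*} [Fintype κ] [Fintype ι]
    {X Y : Matrix κ ι ℂ} (hXY : X * Yᴴ = Y * Xᴴ) :
    ∃ t : ℝ, ∀ f, (Y + (t : ℂ) • X)ᴴ *ᵥ f = 0 → Xᴴ *ᵥ f = 0 := by
  by_contra! hcon
  choose f hf hf' using hcon
  have key : ∀ t, Yᴴ *ᵥ f t = -((t : ℂ) • (Xᴴ *ᵥ f t)) := by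
    intro t
    have := hf t
    rw [conjTranspose_add, conjTranspose_smul, add_mulVec, smul_mulVec] at this
    rw [eq_neg_iff_add_eq_zero]
    simpa using this
  have hsym : ∀ g h : κ → ℂ, star (Xᴴ *ᵥ g) ⬝ᵥ (Yᴴ *ᵥ h) = star (Yᴴ *ᵥ g) ⬝ᵥ (Xᴴ *ᵥ h) := by
    intro g h
    rw [star_mulVec, star_mulVec, conjTranspose_conjTranspose, conjTranspose_conjTranspose,
      ← dotProduct_mulVec, ← dotProduct_mulVec, mulVec_mulVec, mulVec_mulVec, hXY]
  have hli : LinearIndependent ℂ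
      (fun t : ℝ => (WithLp.toLp 2 (Xᴴ *ᵥ f t) : EuclideanSpace ℂ ι)) := by
    apply linearIndependent_of_ne_zero_of_inner_eq_zero
    · intro t ht
      apply hf' t
      simpa using ht
    · intro t s hts
      have := hsym (f t) (f s)
      rw [key, key, star_neg, star_smul, neg_dotProduct, dotProduct_neg, smul_dotProduct,
        dotProduct_smul, neg_inj, ← sub_eq_zero, ← sub_smul] at this
      rw [EuclideanSpace.inner_eq_star_dotProduct, dotProduct_comm]
      rcases smul_eq_zero.1 this with h | h
      · exfalso
        apply hts
        rw [sub_eq_zero] at h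
        simpa using h.symm
      · exact h
  exact not_finite_iff_infinite.2 (inferInstance : Infinite ℝ) hli.finite

theorem exists_unitary_of_hermitian_factor {κ ι : Type*} [Fintype ι]
    [DecidableEq ι] {X Y : Matrix κ ι ℂ} {S : Matrix ι ι ℂ} (hS : S.IsHermitian)
    (h : X = Y * S) :
    ∃ (U : Matrix ι ι ℂ) (d : ι → ℝ), Uᴴ * U = 1 ∧ U * Uᴴ = 1 ∧
      S = U * diagonal (fun i => (d i : ℂ)) * Uᴴ ∧
      ∀ k i, (X * U) k i = d i * (Y * U) k i := by
  obtain ⟨U, d, h1, h2, h3⟩ := hS.exists_unitary_diagonal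
  refine ⟨U, d, h1, h2, h3, fun k i => ?_⟩
  have : X * U = (Y * U) * diagonal (fun i => (d i : ℂ)) := by
    rw [h, h3]
    simp only [Matrix.mul_assoc, h1, Matrix.mul_one]
  rw [this, mul_diagonal, mul_comm]

theorem exists_unitary_real_pencil {κ ι : Type*} [Fintype κ] [Fintype ι]
    [DecidableEq κ] [DecidableEq ι] {X Y : Matrix κ ι ℂ} (hXY : X * Yᴴ = Y * Xᴴ)
    {p q r : ℝ} (hp : 0 ≤ p) (hq : 0 ≤ q)
    (h : ((p : ℂ) • (X * Xᴴ) + (r : ℂ) • (X * Yᴴ + Y * Xᴴ) + (q : ℂ) • (Y * Yᴴ)).PosSemidef) :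
    ∃ U : Matrix ι ι ℂ, U * Uᴴ = 1 ∧ ∀ i, ∃ a b : ℝ, ¬(a = 0 ∧ b = 0) ∧
      0 ≤ p * a ^ 2 + 2 * r * a * b + q * b ^ 2 ∧
      ∀ k, (b : ℂ) * (X * U) k i = a * (Y * U) k i := by
  rcases le_or_gt (r ^ 2) (p * q) with hr | hr
  · obtain ⟨t, ht⟩ := exists_generic_shift hXY
    have hXY' : X * (Y + (t : ℂ) • X)ᴴ = (Y + (t : ℂ) • X) * Xᴴ := by
      rw [conjTranspose_add, conjTranspose_smul, Matrix.mul_add, Matrix.add_mul, hXY]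
      simp
    obtain ⟨S, hS, hXS⟩ := exists_hermitian_factor hXY' ht
    obtain ⟨U, d, -, hU, -, hd⟩ := exists_unitary_of_hermitian_factor hS hXS
    refine ⟨U, hU, fun i => ⟨d i, 1 - d i * t, ?_, ?_, fun k => ?_⟩⟩
    · rintro ⟨h1, h2⟩
      rw [h1] at h2
      norm_num at h2
    · generalize d i = a
      generalize 1 - a * t = b
      rcases (add_nonneg hp hq).eq_or_lt with h0 | h0
      · have hp0 : p = 0 := by linarith
        have hq0 : q = 0 := by linarith
        have hr0 : r = 0 := by
          rw [hp0, zero_mul] at hr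
          exact pow_eq_zero_iff two_ne_zero |>.1 (le_antisymm hr (sq_nonneg r))
        simp [hp0, hq0, hr0]
      · refine nonneg_of_mul_nonneg_right ?_ h0
        nlinarith [sq_nonneg (p * a + r * b), sq_nonneg (r * a + q * b),
          mul_nonneg (sub_nonneg.2 hr) (add_nonneg (sq_nonneg a) (sq_nonneg b))]
    · have := hd k i
      rw [Matrix.add_mul, Matrix.smul_mul, Matrix.add_apply, Matrix.smul_apply, smul_eq_mul] at this
      push_cast
      linear_combination this
  · obtain ⟨σ, hσ, hk⟩ : ∃ σ : ℝ, σ ^ 2 = 1 ∧ 0 < p + q + 2 * (σ * r) := by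
      have hr0 : 0 < |r| := by
        rw [abs_pos]
        rintro rfl
        nlinarith [mul_nonneg hp hq]
      rcases abs_cases r with ⟨h1, h2⟩ | ⟨h1, h2⟩
      · exact ⟨1, by norm_num, by linarith⟩
      · exact ⟨-1, by norm_num, by linarith⟩
    obtain ⟨δ, hδ, hδ2⟩ : ∃ δ : ℝ, 0 < δ ∧ δ ^ 2 = r ^ 2 - p * q :=
      ⟨√(r ^ 2 - p * q), Real.sqrt_pos.2 (by linarith), Real.sq_sqrt (by linarith)⟩
    have hσc : (σ : ℂ) ^ 2 = 1 := by exact_mod_cast hσ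
    have hδc : (δ : ℂ) ^ 2 = r ^ 2 - p * q := by exact_mod_cast hδ2
    set k := p + q + 2 * (σ * r) with hkdef
    set B : Matrix κ ι ℂ := (δ : ℂ) • Y - ((δ * σ : ℝ) : ℂ) • X with hB
    set L : Matrix κ ι ℂ := ((p + σ * r : ℝ) : ℂ) • X + ((r + σ * q : ℝ) : ℂ) • Y with hL
    have hBL : B * Lᴴ = L * Bᴴ := by
      simp only [hB, hL, conjTranspose_add, conjTranspose_sub, conjTranspose_smul, Matrix.mul_add,
        Matrix.mul_sub, Matrix.add_mul, Matrix.sub_mul, Matrix.smul_mul, Matrix.mul_smul, hXY,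
        Complex.star_def, Complex.conj_ofReal]
      module
    have hLB : L * Lᴴ - B * Bᴴ = (k : ℂ) •
        ((p : ℂ) • (X * Xᴴ) + (r : ℂ) • (X * Yᴴ + Y * Xᴴ) + (q : ℂ) • (Y * Yᴴ)) := by
      simp only [hB, hL, conjTranspose_add, conjTranspose_sub, conjTranspose_smul, Matrix.mul_add,
        Matrix.mul_sub, Matrix.add_mul, Matrix.sub_mul, Matrix.smul_mul, Matrix.mul_smul, hXY,
        Complex.star_def, Complex.conj_ofReal]
      ext i j
      simp only [Matrix.add_apply, Matrix.sub_apply, Matrix.smul_apply, smul_eq_mul]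
      push_cast [hkdef]
      generalize (X * Xᴴ) i j = e
      generalize (Y * Xᴴ) i j = f
      generalize (Y * Yᴴ) i j = g
      linear_combination (-g + 2 * σ * f - σ ^ 2 * e) * hδc +
        (p * q * e + 2 * r * q * f + q ^ 2 * g) * hσc
    have hpsd : (L * Lᴴ - B * Bᴴ).PosSemidef := by
      rw [hLB]
      exact h.smul (by exact_mod_cast hk.le)
    obtain ⟨S, hS, hBS, hS1, hS2⟩ := exists_hermitian_contraction_factor hBL hpsd
    obtain ⟨U, d, hU', hU, hSd, hd⟩ := exists_unitary_of_hermitian_factor hS hBS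
    have hd1 : ∀ i, 0 ≤ 1 - d i := by
      refine nonneg_of_posSemidef_unitary_conj hU' (d := fun i => 1 - d i) ?_
      convert hS1 using 1
      have e : diagonal (fun i => ((1 - d i : ℝ) : ℂ)) = 1 - diagonal (fun i => (d i : ℂ)) := by
        rw [← diagonal_one, diagonal_sub]
        simp
      rw [e, Matrix.mul_sub, Matrix.sub_mul, Matrix.mul_one, hU, ← hSd]
    have hd2 : ∀ i, 0 ≤ 1 + d i := by
      refine nonneg_of_posSemidef_unitary_conj hU' (d := fun i => 1 + d i) ?_
      convert hS2 using 1
      have e : diagonal (fun i => ((1 + d i : ℝ) : ℂ)) = 1 + diagonal (fun i => (d i : ℂ)) := by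
        rw [← diagonal_one, diagonal_add]
        simp
      rw [e, Matrix.mul_add, Matrix.add_mul, Matrix.mul_one, hU, ← hSd]
    refine ⟨U, hU, fun i => ⟨δ - d i * (r + σ * q), δ * σ + d i * (p + σ * r), ?_, ?_,
      fun j => ?_⟩⟩
    · rintro ⟨h1, h2⟩
      have : δ * k = 0 := by
        rw [hkdef]
        linear_combination (p + σ * r) * h1 + (r + σ * q) * h2 - δ * q * hσ
      exact (mul_pos hδ hk).ne' this
    · have h1 := hd1 i
      have h2 := hd2 i
      generalize d i = s at *
      have hs : 0 ≤ 1 - s ^ 2 := by nlinarith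
      refine nonneg_of_mul_nonneg_right ?_ hk
      have hLs : (p + σ * r) * (δ - s * (r + σ * q)) +
          (r + σ * q) * (δ * σ + s * (p + σ * r)) = δ * k := by
        rw [hkdef]
        linear_combination δ * q * hσ
      have hBs : δ * σ + s * (p + σ * r) - σ * (δ - s * (r + σ * q)) = s * k := by
        rw [hkdef]
        linear_combination s * q * hσ
      generalize δ - s * (r + σ * q) = a at *
      generalize δ * σ + s * (p + σ * r) = b at *
      have : k * (p * a ^ 2 + 2 * r * a * b + q * b ^ 2) = δ ^ 2 * k ^ 2 * (1 - s ^ 2) := by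
        have hkq : k * (p * a ^ 2 + 2 * r * a * b + q * b ^ 2) =
            ((p + σ * r) * a + (r + σ * q) * b) ^ 2 - δ ^ 2 * (b - σ * a) ^ 2 := by
          rw [hkdef]
          linear_combination (b ^ 2 - 2 * σ * (a * b) + σ ^ 2 * a ^ 2) * hδ2 -
            (p * q * a ^ 2 + 2 * r * q * (a * b) + q ^ 2 * b ^ 2) * hσ
        rw [hkq, hLs, hBs]
        ring
      rw [this]
      positivity
    · have := hd j i
      simp only [hB, hL, Matrix.add_mul, Matrix.sub_mul, Matrix.smul_mul, Matrix.add_apply,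
        Matrix.sub_apply, Matrix.smul_apply, smul_eq_mul] at this
      push_cast at this ⊢
      linear_combination -this

/-- The sesquilinear form on pairs whose diagonal is `hermPairVal Θ`. -/
noncomputable def pairForm (Θ : Matrix (Fin 2) (Fin 2) ℂ) (α β α' β' : ℂ) : ℂ :=
  α * Θ 0 0 * star α' + α * Θ 0 1 * star β' + β * Θ 1 0 * star α' + β * Θ 1 1 * star β'

theorem hermPairVal_eq_pairForm (Θ : Matrix (Fin 2) (Fin 2) ℂ) (α β : ℂ) :
    hermPairVal Θ α β = pairForm Θ α β α β := by
  simp [hermPairVal, pairForm, dotProduct, mulVec, Fin.sum_univ_two]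
  ring

theorem star_pairForm {Θ : Matrix (Fin 2) (Fin 2) ℂ} (hΘ : Θ.IsHermitian) (α β α' β' : ℂ) :
    star (pairForm Θ α β α' β') = pairForm Θ α' β' α β := by
  have h := fun i j => hΘ.apply i j
  simp only [pairForm, star_add, star_mul', star_star, h]
  ring

theorem pairForm_self_eq_re {Θ : Matrix (Fin 2) (Fin 2) ℂ} (hΘ : Θ.IsHermitian) (α β : ℂ) :
    pairForm Θ α β α β = ((pairForm Θ α β α β).re : ℂ) :=
  (Complex.conj_eq_iff_re.1 (star_pairForm hΘ α β α β)).symm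

theorem pairForm_combination (Θ : Matrix (Fin 2) (Fin 2) ℂ) (a b : ℝ) (α₁ β₁ α₂ β₂ : ℂ) :
    pairForm Θ (a * α₁ + b * α₂) (a * β₁ + b * β₂) (a * α₁ + b * α₂) (a * β₁ + b * β₂) =
      a ^ 2 * pairForm Θ α₁ β₁ α₁ β₁ + a * b * (pairForm Θ α₁ β₁ α₂ β₂ +
        pairForm Θ α₂ β₂ α₁ β₁) + b ^ 2 * pairForm Θ α₂ β₂ α₂ β₂ := by
  simp only [pairForm, star_add, star_mul', Complex.star_def, Complex.conj_ofReal]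
  ring

/-- The matrix version of `hermPairVal`. -/
noncomputable def matPairVal {κ ι : Type*} [Fintype ι] (Θ : Matrix (Fin 2) (Fin 2) ℂ)
    (X Y : Matrix κ ι ℂ) : Matrix κ κ ℂ :=
  Θ 0 0 • (X * Xᴴ) + Θ 0 1 • (X * Yᴴ) + Θ 1 0 • (Y * Xᴴ) + Θ 1 1 • (Y * Yᴴ)

theorem matPairVal_combination {κ ι : Type*} [Fintype ι] (Θ : Matrix (Fin 2) (Fin 2) ℂ)
    (X Y : Matrix κ ι ℂ) (α₁ β₁ α₂ β₂ : ℂ) :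
    matPairVal Θ (α₁ • X + α₂ • Y) (β₁ • X + β₂ • Y) =
      pairForm Θ α₁ β₁ α₁ β₁ • (X * Xᴴ) + pairForm Θ α₁ β₁ α₂ β₂ • (X * Yᴴ) +
      pairForm Θ α₂ β₂ α₁ β₁ • (Y * Xᴴ) + pairForm Θ α₂ β₂ α₂ β₂ • (Y * Yᴴ) := by
  simp only [matPairVal, pairForm, conjTranspose_add, conjTranspose_smul, Matrix.mul_add,
    Matrix.add_mul, Matrix.smul_mul, Matrix.mul_smul]
  module

theorem pairForm_ne_zero {Θ : Matrix (Fin 2) (Fin 2) ℂ} (hΘ : Θ.IsHermitian)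
    (hdet : Θ.det.re < 0) {α₁ β₁ α₂ β₂ : ℂ} (hΔ : α₁ * β₂ - β₁ * α₂ ≠ 0)
    (h₁ : pairForm Θ α₁ β₁ α₁ β₁ = 0) : pairForm Θ α₁ β₁ α₂ β₂ ≠ 0 := by
  intro h
  have h' : pairForm Θ α₂ β₂ α₁ β₁ = 0 := by rw [← star_pairForm hΘ, h, star_zero]
  have key : (α₁ * β₂ - β₁ * α₂) * star (α₁ * β₂ - β₁ * α₂) * Θ.det =
      pairForm Θ α₁ β₁ α₁ β₁ * pairForm Θ α₂ β₂ α₂ β₂ -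
        pairForm Θ α₁ β₁ α₂ β₂ * pairForm Θ α₂ β₂ α₁ β₁ := by
    simp only [pairForm, det_fin_two, star_sub, star_mul']
    ring
  rw [h, h', h₁, zero_mul, zero_mul, sub_zero] at key
  have h0 : Θ.det = 0 := (mul_eq_zero.1 key).resolve_left (mul_ne_zero hΔ (star_ne_zero.2 hΔ))
  simp [h0] at hdet

theorem exists_unitary_pencil_of_normalized {κ ι : Type*} [Fintype κ] [Fintype ι]
    [DecidableEq κ] [DecidableEq ι] {X Y : Matrix κ ι ℂ} {Θ₁ Θ₂ : Matrix (Fin 2) (Fin 2) ℂ}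
    (hΘ₁ : Θ₁.IsHermitian) (hΘ₂ : Θ₂.IsHermitian) {α₁ β₁ α₂ β₂ : ℂ}
    (hΔ : α₁ * β₂ - β₁ * α₂ ≠ 0)
    (h11 : pairForm Θ₁ α₁ β₁ α₁ β₁ = 0) (h22 : pairForm Θ₁ α₂ β₂ α₂ β₂ = 0)
    (h12 : pairForm Θ₁ α₁ β₁ α₂ β₂ = Complex.I)
    (hp : 0 ≤ (pairForm Θ₂ α₁ β₁ α₁ β₁).re) (hq : 0 ≤ (pairForm Θ₂ α₂ β₂ α₂ β₂).re)
    (h1 : matPairVal Θ₁ X Y = 0) (h2 : (matPairVal Θ₂ X Y).PosSemidef) :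
    ∃ U : Matrix ι ι ℂ, U * Uᴴ = 1 ∧ ∀ i, ∃ α β : ℂ, ¬(α = 0 ∧ β = 0) ∧
      hermPairVal Θ₁ α β = 0 ∧ 0 ≤ (hermPairVal Θ₂ α β).re ∧
      ∀ k, α * (Y * U) k i = β * (X * U) k i := by
  obtain ⟨X', Y', rfl, rfl⟩ : ∃ X' Y' : Matrix κ ι ℂ, X = α₁ • X' + α₂ • Y' ∧
      Y = β₁ • X' + β₂ • Y' := by
    refine ⟨(α₁ * β₂ - β₁ * α₂)⁻¹ • (β₂ • X - α₂ • Y),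
      (α₁ * β₂ - β₁ * α₂)⁻¹ • (α₁ • Y - β₁ • X), ?_, ?_⟩ <;>
    · ext i j
      simp only [Matrix.add_apply, Matrix.smul_apply, Matrix.sub_apply, smul_eq_mul]
      field_simp
      ring
  have h21 : pairForm Θ₁ α₂ β₂ α₁ β₁ = -Complex.I := by
    rw [← star_pairForm hΘ₁, h12]; simp
  rw [matPairVal_combination] at h1 h2
  rw [h11, h12, h21, h22, zero_smul, zero_smul, zero_add, add_zero, neg_smul, ← sub_eq_add_neg,
    ← smul_sub] at h1
  have hXY : X' * Y'ᴴ = Y' * X'ᴴ := by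
    rcases smul_eq_zero.1 h1 with h | h
    · exact absurd h Complex.I_ne_zero
    · exact sub_eq_zero.1 h
  set r := (pairForm Θ₂ α₁ β₁ α₂ β₂).re with hr
  have hsum : pairForm Θ₂ α₁ β₁ α₂ β₂ + pairForm Θ₂ α₂ β₂ α₁ β₁ = 2 * r := by
    rw [← star_pairForm hΘ₂ α₁ β₁ α₂ β₂, Complex.star_def, Complex.add_conj]
    simp [hr]
  rw [hXY, add_assoc (_ • _), ← add_smul, hsum] at h2
  obtain ⟨U, hU, hab⟩ := exists_unitary_real_pencil hXY (r := r) hp hq (by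
    rw [← pairForm_self_eq_re hΘ₂, ← pairForm_self_eq_re hΘ₂, hXY, ← two_smul ℂ, smul_smul,
      mul_comm (r : ℂ)]
    exact h2)
  refine ⟨U, hU, fun i => ?_⟩
  obtain ⟨a, b, hne, hQ, hx⟩ := hab i
  refine ⟨a * α₁ + b * α₂, a * β₁ + b * β₂, ?_, ?_, ?_, fun k => ?_⟩
  · rintro ⟨e1, e2⟩
    apply hne
    have ha : (a : ℂ) * (α₁ * β₂ - β₁ * α₂) = 0 := by linear_combination β₂ * e1 - α₂ * e2
    have hb : (b : ℂ) * (α₁ * β₂ - β₁ * α₂) = 0 := by linear_combination α₁ * e2 - β₁ * e1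
    simpa [hΔ] using And.intro ha hb
  · rw [hermPairVal_eq_pairForm, pairForm_combination, h11, h22, h12, h21]
    ring
  · rw [hermPairVal_eq_pairForm, pairForm_combination, hsum, pairForm_self_eq_re hΘ₂ α₁,
      pairForm_self_eq_re hΘ₂ α₂]
    convert hQ using 1
    norm_cast
    ring
  · simp only [Matrix.add_mul, Matrix.smul_mul, Matrix.add_apply, Matrix.smul_apply, smul_eq_mul]
    linear_combination (β₁ * α₂ - α₁ * β₂) * hx k

theorem exists_unitary_pencil {κ ι : Type*} [Fintype κ] [Fintype ι]
    [DecidableEq κ] [DecidableEq ι] {X Y : Matrix κ ι ℂ} {Θ₁ Θ₂ : Matrix (Fin 2) (Fin 2) ℂ}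
    (hΘ₁ : Θ₁.IsHermitian) (hΘ₂ : Θ₂.IsHermitian) (hdet : Θ₁.det.re < 0)
    (htwo : ∃ α₁ β₁ α₂ β₂ : ℂ, ¬(α₁ = 0 ∧ β₁ = 0) ∧ ¬(α₂ = 0 ∧ β₂ = 0) ∧
      (∀ c : ℂ, ¬(α₂ = c * α₁ ∧ β₂ = c * β₁)) ∧
      hermPairVal Θ₁ α₁ β₁ = 0 ∧ 0 ≤ (hermPairVal Θ₂ α₁ β₁).re ∧
      hermPairVal Θ₁ α₂ β₂ = 0 ∧ 0 ≤ (hermPairVal Θ₂ α₂ β₂).re)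
    (h1 : matPairVal Θ₁ X Y = 0) (h2 : (matPairVal Θ₂ X Y).PosSemidef) :
    ∃ U : Matrix ι ι ℂ, U * Uᴴ = 1 ∧ ∀ i, ∃ α β : ℂ, ¬(α = 0 ∧ β = 0) ∧
      hermPairVal Θ₁ α β = 0 ∧ 0 ≤ (hermPairVal Θ₂ α β).re ∧
      ∀ k, α * (Y * U) k i = β * (X * U) k i := by
  obtain ⟨α₁, β₁, α₂, β₂, hv1, -, hind, e11, e12, e21, e22⟩ := htwo
  rw [hermPairVal_eq_pairForm] at e11 e12 e21 e22
  have hΔ : α₁ * β₂ - β₁ * α₂ ≠ 0 := by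
    intro h
    by_cases hα : α₁ = 0
    · have hβ : β₁ ≠ 0 := fun hβ => hv1 ⟨hα, hβ⟩
      refine hind (β₂ / β₁) ⟨?_, by field_simp⟩
      rw [hα] at h ⊢
      simpa [hβ] using h
    · refine hind (α₂ / α₁) ⟨by field_simp, ?_⟩
      field_simp
      linear_combination h
  have hc := pairForm_ne_zero hΘ₁ hdet hΔ e11
  set c := Complex.I / pairForm Θ₁ α₁ β₁ α₂ β₂ with hcdef
  have hc0 : c ≠ 0 := div_ne_zero Complex.I_ne_zero hc
  have hscale : ∀ Θ : Matrix (Fin 2) (Fin 2) ℂ, pairForm Θ (c * α₁) (c * β₁) (c * α₁) (c * β₁) =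
      (Complex.normSq c : ℂ) * pairForm Θ α₁ β₁ α₁ β₁ := by
    intro Θ
    rw [← Complex.mul_conj]
    simp only [pairForm, star_mul', Complex.star_def]
    ring
  refine exists_unitary_pencil_of_normalized hΘ₁ hΘ₂ (α₁ := c * α₁) (β₁ := c * β₁) (α₂ := α₂)
    (β₂ := β₂) ?_ ?_ e21 ?_ ?_ e22 h1 h2
  · rw [mul_assoc, mul_assoc, ← mul_sub]
    exact mul_ne_zero hc0 hΔ
  · rw [hscale, e11, mul_zero]
  · have : pairForm Θ₁ (c * α₁) (c * β₁) α₂ β₂ = c * pairForm Θ₁ α₁ β₁ α₂ β₂ := by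
      simp only [pairForm]; ring
    rw [this, hcdef, div_mul_cancel₀ _ hc]
  · rw [hscale, Complex.re_ofReal_mul]
    exact mul_nonneg (Complex.normSq_nonneg c) e12

/-- The generalized Lyapunov operator, dual to `lyapAdj`. -/
noncomputable def lyapDual {k z : Type*} [Fintype z] (M N : Matrix k z ℂ)
    (Θ : Matrix (Fin 2) (Fin 2) ℂ) (W : Matrix z z ℂ) : Matrix k k ℂ :=
  Θ 0 0 • (M * W * Mᴴ) + Θ 0 1 • (M * W * Nᴴ) + Θ 1 0 • (N * W * Mᴴ) + Θ 1 1 • (N * W * Nᴴ)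

theorem matPairVal_mul_mul {k z ι : Type*} [Fintype z] [Fintype ι] (M N : Matrix k z ℂ)
    (Θ : Matrix (Fin 2) (Fin 2) ℂ) (R : Matrix z ι ℂ) :
    matPairVal Θ (M * R) (N * R) = lyapDual M N Θ (R * Rᴴ) := by
  simp only [matPairVal, lyapDual, conjTranspose_mul, Matrix.mul_assoc]

theorem trace_mul_lyapAdj {k z : Type*} [Fintype k] [Fintype z] (M N : Matrix k z ℂ)
    (Θ : Matrix (Fin 2) (Fin 2) ℂ) (W : Matrix z z ℂ) (H : Matrix k k ℂ) :
    (W * lyapAdj M N Θ H).trace = (lyapDual M N Θ W * H).trace := by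
  have h (A B : Matrix k z ℂ) : (W * (Aᴴ * H * B)).trace = (B * W * Aᴴ * H).trace := by
    rw [← Matrix.mul_assoc, trace_mul_comm, Matrix.mul_assoc B, Matrix.mul_assoc B,
      Matrix.mul_assoc W]
  simp only [lyapDual, lyapAdj, Matrix.mul_add, Matrix.add_mul, Matrix.mul_smul, Matrix.smul_mul,
    trace_add, trace_smul, h]
  ring

theorem lyapDual_isHermitian {k z : Type*} [Fintype z] (M N : Matrix k z ℂ)
    {Θ : Matrix (Fin 2) (Fin 2) ℂ} (hΘ : Θ.IsHermitian) {W : Matrix z z ℂ}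
    (hW : W.IsHermitian) : (lyapDual M N Θ W).IsHermitian := by
  have h := fun i j => hΘ.apply i j
  simp only [IsHermitian, lyapDual, conjTranspose_add, conjTranspose_smul, conjTranspose_mul,
    conjTranspose_conjTranspose, hW.eq, h, Matrix.mul_assoc]
  abel

theorem lyapAdj_isHermitian {k z : Type*} [Fintype k] (M N : Matrix k z ℂ)
    {Θ : Matrix (Fin 2) (Fin 2) ℂ} (hΘ : Θ.IsHermitian) {H : Matrix k k ℂ}
    (hH : H.IsHermitian) : (lyapAdj M N Θ H).IsHermitian := by
  have h := fun i j => hΘ.apply i j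
  simp only [IsHermitian, lyapAdj, conjTranspose_add, conjTranspose_smul, conjTranspose_mul,
    conjTranspose_conjTranspose, hH.eq, h, Matrix.mul_assoc]
  abel

theorem dotProduct_lyapAdj_mulVec {k z : Type*} [Fintype k] [Fintype z] {M N : Matrix k z ℂ}
    (Θ : Matrix (Fin 2) (Fin 2) ℂ) (H : Matrix k k ℂ) {w : z → ℂ} {v : k → ℂ} {α β : ℂ}
    (hM : M *ᵥ w = α • v) (hN : N *ᵥ w = β • v) :
    star w ⬝ᵥ lyapAdj M N Θ H *ᵥ w = hermPairVal Θ α β * (star v ⬝ᵥ H *ᵥ v) := by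
  have h {A B : Matrix k z ℂ} {a b : ℂ} (hA : A *ᵥ w = a • v) (hB : B *ᵥ w = b • v) :
      star w ⬝ᵥ (Aᴴ * H * B) *ᵥ w = star a * b * (star v ⬝ᵥ H *ᵥ v) := by
    rw [← mulVec_mulVec, ← mulVec_mulVec, hB, dotProduct_mulVec, ← star_mulVec, hA, star_smul,
      mulVec_smul, smul_dotProduct, dotProduct_smul]
    simp only [smul_eq_mul]
    ring
  simp only [lyapAdj, add_mulVec, smul_mulVec, dotProduct_add, dotProduct_smul, h hM hM, h hM hN,
    h hN hM, h hN hN, hermPairVal_eq_pairForm, pairForm, smul_eq_mul]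
  ring

theorem trace_mul_conjTranspose_mul {z ι : Type*} [Fintype z] [Fintype ι] (R : Matrix z ι ℂ)
    (G : Matrix z z ℂ) :
    (R * Rᴴ * G).trace = ∑ i, star (R.col i) ⬝ᵥ G *ᵥ R.col i := by
  rw [Matrix.mul_assoc, trace_mul_comm, Matrix.mul_assoc]
  simp only [trace, diag, mul_apply, dotProduct, mulVec, conjTranspose_apply, Pi.star_apply,
    col_apply]

/-- A positive semidefinite matrix satisfying the Lyapunov conditions splits into dyads
supported on the kernels of the pencil along the curve. -/
theorem exists_dyadic_decomposition {k z : Type*} [Fintype k] [Fintype z] [DecidableEq k]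
    [DecidableEq z] (M N : Matrix k z ℂ) {Θ₁ Θ₂ : Matrix (Fin 2) (Fin 2) ℂ}
    (hΘ₁ : Θ₁.IsHermitian) (hΘ₂ : Θ₂.IsHermitian) (hdet : Θ₁.det.re < 0)
    (htwo : ∃ α₁ β₁ α₂ β₂ : ℂ, ¬(α₁ = 0 ∧ β₁ = 0) ∧ ¬(α₂ = 0 ∧ β₂ = 0) ∧
      (∀ c : ℂ, ¬(α₂ = c * α₁ ∧ β₂ = c * β₁)) ∧
      hermPairVal Θ₁ α₁ β₁ = 0 ∧ 0 ≤ (hermPairVal Θ₂ α₁ β₁).re ∧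
      hermPairVal Θ₁ α₂ β₂ = 0 ∧ 0 ≤ (hermPairVal Θ₂ α₂ β₂).re)
    {W : Matrix z z ℂ} (hW : W.PosSemidef)
    (h1 : lyapDual M N Θ₁ W = 0) (h2 : (lyapDual M N Θ₂ W).PosSemidef) :
    ∃ R : Matrix z z ℂ, W = R * Rᴴ ∧ ∀ i, ∃ α β : ℂ, ¬(α = 0 ∧ β = 0) ∧
      hermPairVal Θ₁ α β = 0 ∧ 0 ≤ (hermPairVal Θ₂ α β).re ∧
      (α • N - β • M) *ᵥ R.col i = 0 := by
  obtain ⟨U, d, hU, hU', hd⟩ := hW.isHermitian.exists_unitary_diagonal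
  have hd0 := nonneg_of_posSemidef_unitary_conj hU (hd ▸ hW)
  set S := U * diagonal (fun i => ((√(d i) : ℝ) : ℂ)) with hS
  have hWS : W = S * Sᴴ := by
    rw [hS, conjTranspose_mul, diagonal_conjTranspose, Matrix.mul_assoc, ← Matrix.mul_assoc _ _ Uᴴ,
      diagonal_mul_diagonal, ← Matrix.mul_assoc, hd]
    congr! 4 with i
    simp [← Complex.ofReal_mul, Real.mul_self_sqrt (hd0 i)]
  rw [hWS, ← matPairVal_mul_mul] at h1 h2
  obtain ⟨V, hV, h⟩ := exists_unitary_pencil hΘ₁ hΘ₂ hdet htwo h1 h2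
  refine ⟨S * V, ?_, fun i => ?_⟩
  · rw [conjTranspose_mul, Matrix.mul_assoc, ← Matrix.mul_assoc V, hV, Matrix.one_mul, hWS]
  · obtain ⟨α, β, h0, hΓ, hΩ, hk⟩ := h i
    refine ⟨α, β, h0, hΓ, hΩ, ?_⟩
    ext j
    have := hk j
    rw [Matrix.mul_assoc N, Matrix.mul_assoc M] at this
    simp only [sub_mulVec, smul_mulVec, Pi.sub_apply, Pi.smul_apply, Pi.zero_apply, smul_eq_mul]
    rw [sub_eq_zero]
    exact this

/-- Positivity of the real part of the quadratic form of a matrix, without a symmetry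
condition. -/
def QuadPos {ι : Type*} [Fintype ι] (A : Matrix ι ι ℂ) : Prop :=
  ∀ z : ι → ℂ, z ≠ 0 → 0 < (star z ⬝ᵥ A *ᵥ z).re

namespace QuadPos

variable {ι : Type*} [Fintype ι] {A B : Matrix ι ι ℂ}

theorem add (hA : QuadPos A) (hB : QuadPos B) : QuadPos (A + B) := fun z hz => by
  rw [add_mulVec, dotProduct_add, Complex.add_re]
  exact add_pos (hA z hz) (hB z hz)

theorem smul (hA : QuadPos A) {t : ℝ} (ht : 0 < t) : QuadPos (t • A) := fun z hz => by
  rw [smul_mulVec, dotProduct_smul, Complex.real_smul, Complex.re_ofReal_mul]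
  exact mul_pos ht (hA z hz)

theorem one [DecidableEq ι] : QuadPos (1 : Matrix ι ι ℂ) := fun z hz => by
  rw [one_mulVec]
  exact (Complex.pos_iff.1 (dotProduct_star_self_pos_iff.2 hz)).1

theorem dyad_add [DecidableEq ι] (w : ι → ℂ) {ε : ℝ} (hε : 0 < ε) :
    QuadPos (vecMulVec w (star w) + ε • (1 : Matrix ι ι ℂ)) := fun z hz => by
  rw [add_mulVec, dotProduct_add, Complex.add_re]
  refine add_pos_of_nonneg_of_pos ?_ (one.smul hε z hz)
  exact (Complex.nonneg_iff.1 ((posSemidef_vecMulVec_self_star w).dotProduct_mulVec_nonneg z)).1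

theorem posDef (hA : QuadPos A) (h : A.IsHermitian) : A.PosDef :=
  .of_dotProduct_mulVec_pos h fun z hz =>
    Complex.pos_iff.2 ⟨hA z hz, (h.im_star_dotProduct_mulVec_self z).symm⟩

theorem _root_.Matrix.PosDef.quadPos (hA : A.PosDef) : QuadPos A := fun _ hz =>
  (Complex.pos_iff.1 (hA.dotProduct_mulVec_pos hz)).1

theorem iff_sphere : QuadPos A ↔
    ∀ z ∈ Metric.sphere (0 : ι → ℂ) 1, 0 < (star z ⬝ᵥ A *ᵥ z).re := by
  refine ⟨fun h z hz => h z (ne_zero_of_mem_unit_sphere ⟨z, hz⟩), fun h z hz => ?_⟩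
  have hn := norm_pos_iff.2 hz
  have hu := h (‖z‖⁻¹ • z) (by simp [norm_smul, hn.ne'])
  have hs : star (‖z‖⁻¹ • z) = ‖z‖⁻¹ • star z := by simp [star_smul]
  rw [hs, mulVec_smul, smul_dotProduct, dotProduct_smul, Complex.real_smul, Complex.real_smul,
    Complex.re_ofReal_mul, Complex.re_ofReal_mul] at hu
  exact pos_of_mul_pos_right (pos_of_mul_pos_right hu (by positivity)) (by positivity)

theorem isOpen : IsOpen {A : Matrix ι ι ℂ | QuadPos A} := by
  refine isOpen_iff_eventually.2 fun A hA => ?_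
  simp only [Set.mem_ofPred_eq, iff_sphere] at hA ⊢
  refine (isCompact_sphere (0 : ι → ℂ) 1).eventually_forall_of_forall_eventually
    fun z hz => ?_
  have hc : Continuous fun q : Matrix ι ι ℂ × (ι → ℂ) => (star q.2 ⬝ᵥ q.1 *ᵥ q.2).re := by
    fun_prop
  exact hc.continuousAt.eventually_const_lt (hA z hz)

theorem convex : Convex ℝ {A : Matrix ι ι ℂ | QuadPos A} :=
  convex_iff_forall_pos.2 fun _ hA _ hB _ _ ha hb _ =>
    QuadPos.add (QuadPos.smul hA ha) (QuadPos.smul hB hb)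

end QuadPos

theorem convex_isHermitian {ι : Type*} : Convex ℝ {A : Matrix ι ι ℂ | A.IsHermitian} :=
  fun _ hA _ hB a b _ _ _ => (hA.smul (.all a)).add (hB.smul (.all b))

/-- A real linear functional acts on Hermitian matrices through a Hermitian trace pairing. -/
theorem exists_isHermitian_trace_repr {ι : Type*} [Fintype ι] [DecidableEq ι]
    (f : Matrix ι ι ℂ →ₗ[ℝ] ℝ) :
    ∃ W : Matrix ι ι ℂ, W.IsHermitian ∧
      ∀ A : Matrix ι ι ℂ, A.IsHermitian → f A = (W * A).trace.re := by
  set V : Matrix ι ι ℂ := .of fun j i =>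
    ⟨f (single i j 1), -f (single i j Complex.I)⟩ with hV
  have hs (i j : ι) (a : ℂ) : f (single i j a) = (V j i * a).re := by
    have : single i j a = a.re • single i j (1 : ℂ) + a.im • single i j Complex.I := by
      rw [smul_single, smul_single, ← single_add]
      congr 1
      simp [Complex.re_add_im]
    rw [this, map_add, map_smul, map_smul]
    simp [hV, Complex.mul_re]
    ring
  have hf (A : Matrix ι ι ℂ) : f A = (V * A).trace.re := by
    conv_lhs => rw [matrix_eq_sum_single A]
    simp only [map_sum, hs, trace, diag, mul_apply, Complex.re_sum]
    exact Finset.sum_comm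
  refine ⟨(2⁻¹ : ℝ) • (V + Vᴴ), (isHermitian_add_transpose_self V).smul (.all _),
    fun A hA => ?_⟩
  have hA' : (Vᴴ * A).trace.re = (V * A).trace.re := by
    have : (Vᴴ * A) = (A * V)ᴴ := by rw [conjTranspose_mul, hA.eq]
    rw [this, trace_conjTranspose, trace_mul_comm]
    simp
  rw [hf, Matrix.smul_mul, Matrix.add_mul, trace_smul, trace_add, Complex.real_smul,
    Complex.re_ofReal_mul, Complex.add_re, hA']
  ring

theorem eq_zero_of_trace_mul_re_eq_zero {ι : Type*} [Fintype ι] {A : Matrix ι ι ℂ}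
    (hA : A.IsHermitian)
    (h : ∀ B : Matrix ι ι ℂ, B.IsHermitian → (A * B).trace.re = 0) : A = 0 := by
  rw [← trace_mul_conjTranspose_self_eq_zero_iff]
  have h0 := (posSemidef_self_mul_conjTranspose A).trace_nonneg
  refine Complex.ext ?_ (Complex.nonneg_iff.1 h0).2.symm
  rw [hA.eq]
  exact h A hA

theorem posSemidef_of_trace_mul_dyad {ι : Type*} [Fintype ι] {A : Matrix ι ι ℂ}
    (hA : A.IsHermitian) (h : ∀ w : ι → ℂ, 0 ≤ (A * vecMulVec w (star w)).trace.re) :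
    A.PosSemidef := by
  refine .of_dotProduct_mulVec_nonneg hA fun w =>
    Complex.nonneg_iff.2 ⟨?_, (hA.im_star_dotProduct_mulVec_self w).symm⟩
  have := h w
  rwa [mul_vecMulVec, trace_vecMulVec, dotProduct_comm] at this

theorem lyapAdj_add {k z : Type*} [Fintype k] (M N : Matrix k z ℂ)
    (Θ : Matrix (Fin 2) (Fin 2) ℂ) (H K : Matrix k k ℂ) :
    lyapAdj M N Θ (H + K) = lyapAdj M N Θ H + lyapAdj M N Θ K := by
  simp only [lyapAdj, Matrix.mul_add, Matrix.add_mul, smul_add]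
  abel

theorem lyapAdj_smul {k z : Type*} [Fintype k] (M N : Matrix k z ℂ)
    (Θ : Matrix (Fin 2) (Fin 2) ℂ) (t : ℝ) (H : Matrix k k ℂ) :
    lyapAdj M N Θ (t • H) = t • lyapAdj M N Θ H := by
  simp only [lyapAdj, Matrix.mul_smul, Matrix.smul_mul, smul_add, smul_comm t]

theorem eq_zero_of_forall_le_add_mul {a c u : ℝ} (h : ∀ t : ℝ, u ≤ a + t * c) : c = 0 := by
  by_contra hc
  have := h ((u - a - 1) / c)
  rw [div_mul_cancel₀ _ hc] at this
  linarith

/-- The theorem of alternatives for the pair of Lyapunov inequalities. -/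
theorem exists_dual_certificate {k z : Type*} [Fintype k] [Fintype z] [DecidableEq k]
    [DecidableEq z] (M N : Matrix k z ℂ) {Θ₁ Θ₂ : Matrix (Fin 2) (Fin 2) ℂ}
    (hΘ₁ : Θ₁.IsHermitian) (hΘ₂ : Θ₂.IsHermitian) {G : Matrix z z ℂ} (hG : G.IsHermitian)
    (hno : ∀ H₁ H₂ : Matrix k k ℂ, H₁.IsHermitian → H₂.IsHermitian → QuadPos H₂ →
      ¬ QuadPos (G - (lyapAdj M N Θ₁ H₁ + lyapAdj M N Θ₂ H₂))) :
    ∃ W : Matrix z z ℂ, W.PosSemidef ∧ W ≠ 0 ∧ (W * G).trace.re ≤ 0 ∧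
      lyapDual M N Θ₁ W = 0 ∧ (lyapDual M N Θ₂ W).PosSemidef := by
  obtain ⟨f, u, hO, hC⟩ := geometric_hahn_banach_open
    (s := {A : Matrix z z ℂ | QuadPos A} ×ˢ {B : Matrix k k ℂ | QuadPos B})
    (t := (fun q : Matrix k k ℂ × Matrix k k ℂ =>
      (G - (lyapAdj M N Θ₁ q.1 + lyapAdj M N Θ₂ q.2), q.2)) ''
        ({H | H.IsHermitian} ×ˢ {H | H.IsHermitian}))
    (QuadPos.convex.prod QuadPos.convex) (QuadPos.isOpen.prod QuadPos.isOpen)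
    (by
      rintro _ ⟨⟨H, H'⟩, ⟨h1, h2⟩, rfl⟩ _ ⟨⟨K, K'⟩, ⟨h3, h4⟩, rfl⟩ a b ha hb hab
      refine ⟨a • (H, H') + b • (K, K'), ⟨convex_isHermitian h1 h3 ha hb hab,
        convex_isHermitian h2 h4 ha hb hab⟩, ?_⟩
      have hGab : G = a • G + b • G := by rw [← add_smul, hab, one_smul]
      simp only [Prod.smul_mk, Prod.mk_add_mk, lyapAdj_add,
        lyapAdj_smul, Prod.mk.injEq, and_true]
      conv_lhs => rw [hGab]
      simp only [smul_sub, smul_add]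
      abel)
    (by
      rw [Set.disjoint_left]
      rintro _ ⟨h1, h2⟩ ⟨⟨H, H'⟩, ⟨h3, h4⟩, rfl⟩
      exact hno H H' h3 h4 h2 h1)
  have hO' {A : Matrix z z ℂ} {B : Matrix k k ℂ} (hA : QuadPos A) (hB : QuadPos B) (t : ℝ)
      (ht : 0 < t) : t * f (A, B) < u := by
    have := hO (t • A, t • B) ⟨hA.smul ht, hB.smul ht⟩
    rwa [← Prod.smul_mk, map_smul, smul_eq_mul] at this
  have hcone {A : Matrix z z ℂ} {B : Matrix k k ℂ} (hA : QuadPos A) (hB : QuadPos B) :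
      f (A, B) ≤ 0 := by
    by_contra! h
    have := hO' hA hB ((|u| + 1) / f (A, B)) (by positivity)
    rw [div_mul_cancel₀ _ h.ne'] at this
    linarith [le_abs_self u]
  have hu : 0 ≤ u := by
    by_contra! h
    have h1 := hcone (QuadPos.one (ι := z)) (QuadPos.one (ι := k))
    rcases h1.lt_or_eq with h1 | h1
    · have := hO' (QuadPos.one (ι := z)) (QuadPos.one (ι := k)) _ (div_pos_of_neg_of_neg h h1)
      rw [div_mul_cancel₀ _ h1.ne] at this
      exact this.false
    · have := hO' (QuadPos.one (ι := z)) (QuadPos.one (ι := k)) 1 one_pos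
      rw [h1] at this
      linarith
  have hC' (H₁ H₂ : Matrix k k ℂ) (h1 : H₁.IsHermitian) (h2 : H₂.IsHermitian) (t : ℝ) :
      u ≤ f (G, 0) + t * f (-(lyapAdj M N Θ₁ H₁ + lyapAdj M N Θ₂ H₂), H₂) := by
    have := hC _ ⟨(t • H₁, t • H₂), ⟨h1.smul (.all t), h2.smul (.all t)⟩, rfl⟩
    rw [← smul_eq_mul, ← map_smul, ← map_add]
    convert this using 2
    simp only [Prod.smul_mk, Prod.mk_add_mk, lyapAdj_smul, zero_add, smul_neg, smul_add,
      sub_eq_add_neg]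
  have hlin (H₁ H₂ : Matrix k k ℂ) (h1 : H₁.IsHermitian) (h2 : H₂.IsHermitian) :
      f (-(lyapAdj M N Θ₁ H₁ + lyapAdj M N Θ₂ H₂), H₂) = 0 :=
    eq_zero_of_forall_le_add_mul (hC' H₁ H₂ h1 h2)
  have hfG : u ≤ f (G, 0) := by simpa using hC' 0 0 isHermitian_zero isHermitian_zero 0
  obtain ⟨V, hV, hfV⟩ := exists_isHermitian_trace_repr
    (f.toLinearMap ∘ₗ LinearMap.inl ℝ (Matrix z z ℂ) (Matrix k k ℂ))
  obtain ⟨T, hT, hfT⟩ := exists_isHermitian_trace_repr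
    (f.toLinearMap ∘ₗ LinearMap.inr ℝ (Matrix z z ℂ) (Matrix k k ℂ))
  have hf (A : Matrix z z ℂ) (B : Matrix k k ℂ) (hA : A.IsHermitian) (hB : B.IsHermitian) :
      f (A, B) = (V * A).trace.re + (T * B).trace.re := by
    rw [← hfV A hA, ← hfT B hB]
    simp [← map_add]
  have h0z : (0 : Matrix z z ℂ).IsHermitian := isHermitian_zero
  have h0k : (0 : Matrix k k ℂ).IsHermitian := isHermitian_zero
  have hLV₁ : lyapDual M N Θ₁ V = 0 := by
    refine eq_zero_of_trace_mul_re_eq_zero (lyapDual_isHermitian M N hΘ₁ hV) fun H hH => ?_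
    have := hlin H 0 hH h0k
    have hz : lyapAdj M N Θ₂ 0 = 0 := by simp [lyapAdj]
    rw [hz, add_zero, hf _ _ (lyapAdj_isHermitian M N hΘ₁ hH).neg h0k, Matrix.mul_neg, trace_neg,
      trace_mul_lyapAdj] at this
    simpa using this
  have hLV₂ : lyapDual M N Θ₂ V = T := by
    refine sub_eq_zero.1 (eq_zero_of_trace_mul_re_eq_zero
      ((lyapDual_isHermitian M N hΘ₂ hV).sub hT) fun H hH => ?_)
    have := hlin 0 H h0k hH
    have hz : lyapAdj M N Θ₁ 0 = 0 := by simp [lyapAdj]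
    rw [hz, zero_add, hf _ _ (lyapAdj_isHermitian M N hΘ₂ hH).neg hH, Matrix.mul_neg, trace_neg,
      trace_mul_lyapAdj, Complex.neg_re] at this
    rw [Matrix.sub_mul, trace_sub, Complex.sub_re]
    linarith
  have hlim {a b : ℝ} (h : ∀ ε : ℝ, 0 < ε → a + ε * b ≤ 0) : a ≤ 0 := by
    by_contra! ha
    have := h (a / (2 * (|b| + 1))) (by positivity)
    have hb : a / (2 * (|b| + 1)) * -b ≤ a / 2 := by
      rw [div_mul_eq_mul_div, div_le_div_iff₀ (by positivity) two_pos]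
      nlinarith [neg_abs_le b, abs_nonneg b]
    linarith
  have hVneg : (-V).PosSemidef := by
    refine posSemidef_of_trace_mul_dyad hV.neg fun w => ?_
    have h1 : (V * vecMulVec w (star w)).trace.re ≤ 0 := by
      refine hlim (b := f (1, 1)) fun ε hε => ?_
      have := hcone (QuadPos.dyad_add w hε) ((QuadPos.one (ι := k)).smul hε)
      have he : (vecMulVec w (star w) + ε • (1 : Matrix z z ℂ), ε • (1 : Matrix k k ℂ)) =
        (vecMulVec w (star w), (0 : Matrix k k ℂ)) + ε • (1, 1) := by simp
      rw [he, map_add, map_smul, hf _ _ (posSemidef_vecMulVec_self_star w).isHermitian h0k] at this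
      simpa using this
    rw [Matrix.neg_mul, trace_neg, Complex.neg_re]
    linarith
  have hTneg : (-T).PosSemidef := by
    refine posSemidef_of_trace_mul_dyad hT.neg fun w => ?_
    have h1 : (T * vecMulVec w (star w)).trace.re ≤ 0 := by
      refine hlim (b := f (1, 1)) fun ε hε => ?_
      have := hcone ((QuadPos.one (ι := z)).smul hε) (QuadPos.dyad_add w hε)
      have he : (ε • (1 : Matrix z z ℂ), vecMulVec w (star w) + ε • (1 : Matrix k k ℂ)) =
        ((0 : Matrix z z ℂ), vecMulVec w (star w)) + ε • (1, 1) := by simp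
      rw [he, map_add, map_smul, hf _ _ h0z (posSemidef_vecMulVec_self_star w).isHermitian] at this
      simpa using this
    rw [Matrix.neg_mul, trace_neg, Complex.neg_re]
    linarith
  have hneg (Θ : Matrix (Fin 2) (Fin 2) ℂ) : lyapDual M N Θ (-V) = -lyapDual M N Θ V := by
    simp only [lyapDual, Matrix.mul_neg, Matrix.neg_mul, smul_neg]
    abel
  refine ⟨-V, hVneg, ?_, ?_, ?_, ?_⟩
  · intro hV0
    have hV0 : V = 0 := neg_eq_zero.1 hV0
    have hT0 : T = 0 := by rw [← hLV₂, hV0]; simp [lyapDual]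
    have h1 := hO' (QuadPos.one (ι := z)) (QuadPos.one (ι := k)) 1 one_pos
    rw [hf _ _ isHermitian_one isHermitian_one] at h1
    rw [hf _ _ hG h0k] at hfG
    simp [hV0, hT0] at h1 hfG
    linarith
  · rw [hf _ _ hG h0k] at hfG
    rw [Matrix.neg_mul, trace_neg, Complex.neg_re]
    simp at hfG
    linarith
  · rw [hneg, hLV₁, neg_zero]
  · rwa [hneg, hLV₂]

/-- The elementary tensor of two coordinate vectors. -/
def tensorVec {ι ζ : Type*} (c : ι → ℂ) (z : ζ → ℂ) : ι × ζ → ℂ := fun q => c q.1 * z q.2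

/-- The matrix assembled from a square array of blocks. -/
def blockMat {ι ζ : Type*} (G : ι → ι → Matrix ζ ζ ℂ) : Matrix (ι × ζ) (ι × ζ) ℂ :=
  .of fun q r => G q.1 r.1 q.2 r.2

/-- The array of sesquilinear values of a family of matrices on one vector. -/
noncomputable def formMat {ι ζ : Type*} [Fintype ζ] (G : ι → ι → Matrix ζ ζ ℂ) (z : ζ → ℂ) :
    Matrix ι ι ℂ :=
  .of fun i j => star z ⬝ᵥ G i j *ᵥ z

theorem blockMat_isHermitian {ι ζ : Type*} {G : ι → ι → Matrix ζ ζ ℂ}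
    (hG : ∀ i j, G i j = (G j i)ᴴ) : (blockMat G).IsHermitian := by
  ext q r
  simp [blockMat, hG q.1 r.1]

theorem formMat_isHermitian {ι ζ : Type*} [Fintype ζ] {G : ι → ι → Matrix ζ ζ ℂ}
    (hG : ∀ i j, G i j = (G j i)ᴴ) (z : ζ → ℂ) : (formMat G z).IsHermitian := by
  ext i j
  simp only [formMat, conjTranspose_apply, of_apply]
  rw [hG i j, star_dotProduct, star_mulVec, dotProduct_mulVec, star_star]

theorem tensorVec_dotProduct_blockMat {ι ζ : Type*} [Fintype ι] [Fintype ζ]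
    (G : ι → ι → Matrix ζ ζ ℂ) (c : ι → ℂ) (z : ζ → ℂ) :
    star (tensorVec c z) ⬝ᵥ blockMat G *ᵥ tensorVec c z = star c ⬝ᵥ formMat G z *ᵥ c := by
  simp only [dotProduct, mulVec, blockMat, formMat, tensorVec, of_apply, Pi.star_apply, star_mul',
    Fintype.sum_prod_type, Finset.mul_sum, Finset.sum_mul]
  refine Finset.sum_congr rfl fun i _ => ?_
  rw [Finset.sum_comm]
  refine Finset.sum_congr rfl fun j _ => Finset.sum_congr rfl fun a _ =>
    Finset.sum_congr rfl fun b _ => ?_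
  ring

theorem idKron_mulVec {κ ζ : Type*} [Fintype ζ] (m : ℕ) (M : Matrix κ ζ ℂ)
    (w : Fin m × ζ → ℂ) (q : Fin m × κ) :
    (idKron m M *ᵥ w) q = (M *ᵥ fun b => w (q.1, b)) q.2 := by
  simp [mulVec, dotProduct, idKron, Fintype.sum_prod_type, kroneckerMap_apply, one_apply, ite_mul]

theorem pencil_mulVec_eq_zero_iff {κ ζ : Type*} [Fintype ζ] {M N : Matrix κ ζ ℂ} {α β : ℂ}
    {z : ζ → ℂ} : (α • N - β • M) *ᵥ z = 0 ↔ α • (N *ᵥ z) = β • (M *ᵥ z) := by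
  rw [sub_mulVec, smul_mulVec, smul_mulVec, sub_eq_zero]

theorem pencil_idKron_mulVec_eq_zero_iff {κ ζ : Type*} [Fintype ζ] {m : ℕ} {M N : Matrix κ ζ ℂ}
    {α β : ℂ} {w : Fin m × ζ → ℂ} : (α • idKron m N - β • idKron m M) *ᵥ w = 0 ↔
      ∀ i, (α • N - β • M) *ᵥ (fun b => w (i, b)) = 0 := by
  simp only [pencil_mulVec_eq_zero_iff]
  simp only [funext_iff, Pi.smul_apply, idKron_mulVec, Prod.forall]

theorem exists_common_direction {κ ζ : Type*} [Fintype ζ] {M N : Matrix κ ζ ℂ} {α β : ℂ}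
    (h0 : ¬(α = 0 ∧ β = 0)) {z : ζ → ℂ} (hz : (α • N - β • M) *ᵥ z = 0) :
    ∃ v : κ → ℂ, M *ᵥ z = α • v ∧ N *ᵥ z = β • v := by
  rw [pencil_mulVec_eq_zero_iff] at hz
  by_cases hα : α = 0
  · have hβ : β ≠ 0 := fun h => h0 ⟨hα, h⟩
    refine ⟨β⁻¹ • (N *ᵥ z), ?_, by rw [smul_inv_smul₀ hβ]⟩
    rw [smul_comm, hz, inv_smul_smul₀ hβ]
  · refine ⟨α⁻¹ • (M *ᵥ z), by rw [smul_inv_smul₀ hα], ?_⟩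
    rw [smul_comm, ← hz, inv_smul_smul₀ hα]

theorem formMat_posDef_of_lmi {κ ζ : Type*} [Fintype κ] [Fintype ζ] {m : ℕ} {M N : Matrix κ ζ ℂ}
    {Θ₁ Θ₂ : Matrix (Fin 2) (Fin 2) ℂ} (hΘ₂ : Θ₂.IsHermitian)
    {G : Fin m → Fin m → Matrix ζ ζ ℂ} (hG : ∀ i j, G i j = (G j i)ᴴ)
    {H₁ H₂ : Matrix (Fin m × κ) (Fin m × κ) ℂ} (hH₂ : H₂.PosDef)
    (hL : (blockMat G - (lyapAdj (idKron m M) (idKron m N) Θ₁ H₁ +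
      lyapAdj (idKron m M) (idKron m N) Θ₂ H₂)).PosDef)
    {α β : ℂ} (h0 : ¬(α = 0 ∧ β = 0)) (hΓ : hermPairVal Θ₁ α β = 0)
    (hΩ : 0 ≤ (hermPairVal Θ₂ α β).re) {z : ζ → ℂ} (hz0 : z ≠ 0)
    (hz : (α • N - β • M) *ᵥ z = 0) : (formMat G z).PosDef := by
  refine QuadPos.posDef (fun c hc => ?_) (formMat_isHermitian hG z)
  have hw : (α • idKron m N - β • idKron m M) *ᵥ tensorVec c z = 0 := by
    refine pencil_idKron_mulVec_eq_zero_iff.2 fun i => ?_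
    change (α • N - β • M) *ᵥ (c i • z) = 0
    rw [mulVec_smul, hz, smul_zero]
  obtain ⟨v, hM, hN⟩ := exists_common_direction h0 hw
  have hw0 : tensorVec c z ≠ 0 := by
    obtain ⟨i, hi⟩ := Function.ne_iff.1 hc
    obtain ⟨b, hb⟩ := Function.ne_iff.1 hz0
    exact Function.ne_iff.2 ⟨(i, b), mul_ne_zero hi hb⟩
  have h := hL.quadPos _ hw0
  have hre : hermPairVal Θ₂ α β = ((hermPairVal Θ₂ α β).re : ℂ) := by
    rw [hermPairVal_eq_pairForm]
    exact pairForm_self_eq_re hΘ₂ α β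
  rw [sub_mulVec, add_mulVec, dotProduct_sub, dotProduct_add, dotProduct_lyapAdj_mulVec _ _ hM hN,
    dotProduct_lyapAdj_mulVec _ _ hM hN, hΓ, zero_mul, zero_add, hre, Complex.sub_re,
    Complex.re_ofReal_mul, tensorVec_dotProduct_blockMat] at h
  have hv := mul_nonneg hΩ (Complex.nonneg_iff.1 (hH₂.posSemidef.dotProduct_mulVec_nonneg v)).1
  linarith

theorem exists_tensorVec_of_finrank_ker_le_one {κ ζ : Type*} [Fintype ζ] {m : ℕ}
    {P : Matrix κ ζ ℂ} (hP : Module.finrank ℂ (LinearMap.ker P.mulVecLin) ≤ 1)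
    {w : Fin m × ζ → ℂ} (hw0 : w ≠ 0) (hw : ∀ i, P *ᵥ (fun b => w (i, b)) = 0) :
    ∃ c z, c ≠ 0 ∧ z ≠ 0 ∧ P *ᵥ z = 0 ∧ w = tensorVec c z := by
  obtain ⟨z, hz⟩ := finrank_le_one_iff.1 hP
  choose c hc using fun i => hz ⟨fun b => w (i, b), hw i⟩
  have hwt : w = tensorVec c z.1 := by
    ext ⟨i, b⟩
    exact (congrFun (congrArg Subtype.val (hc i)) b).symm
  refine ⟨c, z, ?_, ?_, z.2, hwt⟩
  · rintro rfl
    exact hw0 (hwt.trans (by ext; simp [tensorVec]))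
  · intro h
    exact hw0 (hwt.trans (by ext; simp [tensorVec, h]))

theorem exists_tensorVec_of_dims {n nz m : ℕ} {P : Matrix (Fin n) (Fin nz) ℂ}
    (hdims : m = 1 ∨ (nz = n + 1 ∧ P.rank = n))
    {w : Fin m × Fin nz → ℂ} (hw0 : w ≠ 0) (hw : ∀ i, P *ᵥ (fun b => w (i, b)) = 0) :
    ∃ c z, c ≠ 0 ∧ z ≠ 0 ∧ P *ᵥ z = 0 ∧ w = tensorVec c z := by
  rcases hdims with rfl | ⟨hnz, hr⟩
  · have hwt : w = tensorVec (fun _ : Fin 1 => 1) fun b => w (0, b) := by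
      ext ⟨i, b⟩
      simp [tensorVec, Subsingleton.elim i 0]
    refine ⟨_, _, Function.ne_iff.2 ⟨0, one_ne_zero⟩, fun h => hw0 ?_, hw 0, hwt⟩
    rw [hwt, h]
    ext
    simp [tensorVec]
  · refine exists_tensorVec_of_finrank_ker_le_one ?_ hw0 hw
    have := P.mulVecLin.finrank_range_add_finrank_ker
    rw [Module.finrank_fin_fun] at this
    rw [Matrix.rank] at hr
    omega

theorem exists_lmi_of_formMat_posDef {n nz m : ℕ} {M N : Matrix (Fin n) (Fin nz) ℂ}
    {Θ₁ Θ₂ : Matrix (Fin 2) (Fin 2) ℂ} (hΘ₁ : Θ₁.IsHermitian) (hΘ₂ : Θ₂.IsHermitian)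
    (hdet : Θ₁.det.re < 0)
    (htwo : ∃ α₁ β₁ α₂ β₂ : ℂ, ¬(α₁ = 0 ∧ β₁ = 0) ∧ ¬(α₂ = 0 ∧ β₂ = 0) ∧
      (∀ c : ℂ, ¬(α₂ = c * α₁ ∧ β₂ = c * β₁)) ∧
      hermPairVal Θ₁ α₁ β₁ = 0 ∧ 0 ≤ (hermPairVal Θ₂ α₁ β₁).re ∧
      hermPairVal Θ₁ α₂ β₂ = 0 ∧ 0 ≤ (hermPairVal Θ₂ α₂ β₂).re)
    {G : Fin m → Fin m → Matrix (Fin nz) (Fin nz) ℂ} (hG : ∀ i j, G i j = (G j i)ᴴ)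
    (hdims : ∀ α β : ℂ, ¬(α = 0 ∧ β = 0) → hermPairVal Θ₁ α β = 0 →
      0 ≤ (hermPairVal Θ₂ α β).re → m = 1 ∨ (nz = n + 1 ∧ (α • N - β • M).rank = n))
    (hpos : ∀ α β : ℂ, ¬(α = 0 ∧ β = 0) → hermPairVal Θ₁ α β = 0 →
      0 ≤ (hermPairVal Θ₂ α β).re → ∀ z : Fin nz → ℂ, z ≠ 0 → (α • N - β • M) *ᵥ z = 0 →
        (formMat G z).PosDef) :
    ∃ H₁ H₂ : Matrix (Fin m × Fin n) (Fin m × Fin n) ℂ, H₁.IsHermitian ∧ H₂.IsHermitian ∧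
      QuadPos H₂ ∧ QuadPos (blockMat G - (lyapAdj (idKron m M) (idKron m N) Θ₁ H₁ +
        lyapAdj (idKron m M) (idKron m N) Θ₂ H₂)) := by
  by_contra! hno
  obtain ⟨W, hW, hW0, htr, h1, h2⟩ := exists_dual_certificate (idKron m M) (idKron m N) hΘ₁ hΘ₂
    (blockMat_isHermitian hG) hno
  obtain ⟨R, rfl, hR⟩ := exists_dyadic_decomposition _ _ hΘ₁ hΘ₂ hdet htwo hW h1 h2
  have hcol (i) (hi : R.col i ≠ 0) : 0 < (star (R.col i) ⬝ᵥ blockMat G *ᵥ R.col i).re := by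
    obtain ⟨α, β, h0, hΓ, hΩ, hk⟩ := hR i
    obtain ⟨c, z, hc, hz, hPz, hw⟩ := exists_tensorVec_of_dims (hdims α β h0 hΓ hΩ) hi
      (pencil_idKron_mulVec_eq_zero_iff.1 hk)
    rw [hw, tensorVec_dotProduct_blockMat]
    exact (hpos α β h0 hΓ hΩ z hz hPz).quadPos c hc
  have hR0 : ∃ i, R.col i ≠ 0 := by
    by_contra! h
    have : R = 0 := by
      ext a i
      exact congrFun (h i) a
    exact hW0 (by rw [this, Matrix.zero_mul])
  obtain ⟨i, hi⟩ := hR0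
  rw [trace_mul_conjTranspose_mul, Complex.re_sum] at htr
  refine htr.not_gt (Finset.sum_pos' (fun j _ => ?_) ⟨i, Finset.mem_univ i, hcol i hi⟩)
  by_cases hj : R.col j = 0
  · simp [hj]
  · exact (hcol j hj).le

theorem continuous_lyapAdj_idKron (k z m : ℕ) :
    Continuous fun q : Matrix (Fin k) (Fin z) ℂ × Matrix (Fin k) (Fin z) ℂ ×
      Matrix (Fin 2) (Fin 2) ℂ × Matrix (Fin m × Fin k) (Fin m × Fin k) ℂ =>
      lyapAdj (idKron m q.1) (idKron m q.2.1) q.2.2.1 q.2.2.2 := by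
  have h : Continuous (idKron m : Matrix (Fin k) (Fin z) ℂ → _) := by
    refine continuous_matrix fun i j => ?_
    simp only [idKron, kroneckerMap_apply]
    fun_prop
  have h1 := h.comp (continuous_fst : Continuous fun q : Matrix (Fin k) (Fin z) ℂ ×
    Matrix (Fin k) (Fin z) ℂ × Matrix (Fin 2) (Fin 2) ℂ ×
      Matrix (Fin m × Fin k) (Fin m × Fin k) ℂ => q.1)
  have h2 := h.comp (continuous_fst.comp continuous_snd : Continuous fun q :
    Matrix (Fin k) (Fin z) ℂ × Matrix (Fin k) (Fin z) ℂ × Matrix (Fin 2) (Fin 2) ℂ ×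
      Matrix (Fin m × Fin k) (Fin m × Fin k) ℂ => q.2.1)
  simp only [Function.comp_def] at h1 h2
  simp only [lyapAdj]
  fun_prop

/-- Solutions of a family of linear matrix inequalities can be chosen continuously over a
compact parameter space. -/
theorem exists_continuous_lmi_solution {D : Type*} [TopologicalSpace D] [CompactSpace D]
    {n nz m : ℕ} {M N : D → Matrix (Fin n) (Fin nz) ℂ} (hM : Continuous M) (hN : Continuous N)
    {G : D → Matrix (Fin m × Fin nz) (Fin m × Fin nz) ℂ} (hG : Continuous G)
    {Θ₁ Θ₂ : D → Matrix (Fin 2) (Fin 2) ℂ} (hΘ₁ : Continuous Θ₁) (hΘ₂ : Continuous Θ₂)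
    (h : ∀ p, ∃ H₁ H₂ : Matrix (Fin m × Fin n) (Fin m × Fin n) ℂ, H₁.IsHermitian ∧
      H₂.IsHermitian ∧ QuadPos H₂ ∧
      QuadPos (G p - (lyapAdj (idKron m (M p)) (idKron m (N p)) (Θ₁ p) H₁ +
        lyapAdj (idKron m (M p)) (idKron m (N p)) (Θ₂ p) H₂))) :
    ∃ H₁ H₂ : C(D, Matrix (Fin m × Fin n) (Fin m × Fin n) ℂ), ∀ p, (H₁ p).IsHermitian ∧
      (H₂ p).IsHermitian ∧ QuadPos (H₂ p) ∧
      QuadPos (G p - (lyapAdj (idKron m (M p)) (idKron m (N p)) (Θ₁ p) (H₁ p) +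
        lyapAdj (idKron m (M p)) (idKron m (N p)) (Θ₂ p) (H₂ p))) := by
  set φ := fun p => (M p, N p, G p, Θ₁ p, Θ₂ p) with hφ
  have hφc : Continuous φ := by fun_prop
  have : CompactSpace (Set.range φ) := isCompact_iff_compactSpace.1 (isCompact_range hφc)
  let L := fun (x : Set.range φ) (H : Matrix (Fin m × Fin n) (Fin m × Fin n) ℂ ×
      Matrix (Fin m × Fin n) (Fin m × Fin n) ℂ) =>
    x.1.2.2.1 - (lyapAdj (idKron m x.1.1) (idKron m x.1.2.1) x.1.2.2.2.1 H.1 +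
      lyapAdj (idKron m x.1.1) (idKron m x.1.2.1) x.1.2.2.2.2 H.2)
  let t := fun x : Set.range φ => {H : Matrix (Fin m × Fin n) (Fin m × Fin n) ℂ ×
    Matrix (Fin m × Fin n) (Fin m × Fin n) ℂ |
      H.1.IsHermitian ∧ H.2.IsHermitian ∧ QuadPos H.2 ∧ QuadPos (L x H)}
  obtain ⟨g, hg⟩ := exists_continuous_forall_mem_convex_of_local_const (t := t)
    (by
      rintro x ⟨H, H'⟩ ⟨h1, h2, h3, h4⟩ ⟨K, K'⟩ ⟨k1, k2, k3, k4⟩ a b ha hb hab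
      refine ⟨convex_isHermitian h1 k1 ha hb hab, convex_isHermitian h2 k2 ha hb hab,
        QuadPos.convex h3 k3 ha hb hab, ?_⟩
      have hL := QuadPos.convex h4 k4 ha hb hab
      rw [Set.mem_ofPred_eq] at hL
      convert hL using 1
      have hGab : x.1.2.2.1 = a • x.1.2.2.1 + b • x.1.2.2.1 := by
        rw [← add_smul, hab, one_smul]
      simp only [L, Prod.smul_mk, Prod.mk_add_mk, lyapAdj_add, lyapAdj_smul]
      conv_lhs => rw [hGab]
      simp only [smul_sub, smul_add]
      abel)
    (by
      rintro ⟨_, p, rfl⟩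
      obtain ⟨H₁, H₂, h1, h2, h3, h4⟩ := h p
      refine ⟨(H₁, H₂), ?_⟩
      have hc : Continuous fun x => L x (H₁, H₂) := by
        have c := continuous_lyapAdj_idKron n nz m
        have c1 := c.comp (f := fun x : Set.range φ => (x.1.1, x.1.2.1, x.1.2.2.2.1, H₁))
          (by fun_prop)
        have c2 := c.comp (f := fun x : Set.range φ => (x.1.1, x.1.2.1, x.1.2.2.2.2, H₂))
          (by fun_prop)
        exact (by fun_prop : Continuous fun x : Set.range φ => x.1.2.2.1).sub (c1.add c2)
      filter_upwards [(QuadPos.isOpen.preimage hc).mem_nhds h4] with x hx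
      exact ⟨h1, h2, h3, hx⟩)
  refine ⟨⟨fun p => (g ⟨φ p, p, rfl⟩).1, by fun_prop⟩, ⟨fun p => (g ⟨φ p, p, rfl⟩).2, by fun_prop⟩,
    fun p => hg ⟨φ p, p, rfl⟩⟩

/-- **Parameter-dependent Yakubovich Lemma.**
Under continuous dependence on a parameter `p` ranging over a compact space `D`, the
parameter-dependent (matrix) frequency-domain inequality holds for all `p` iff the
corresponding LMI has a solution `(H₁(p), H₂(p))` depending continuously on `p`. -/
theorem parameter_dependent_yakubovich_lemma
    {D : Type*} [TopologicalSpace D] [CompactSpace D]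
    (n nz m : ℕ)
    (M N : D → Matrix (Fin n) (Fin nz) ℂ)
    (hMcont : Continuous M) (hNcont : Continuous N)
    (G : Fin m → Fin m → D → Matrix (Fin nz) (Fin nz) ℂ)
    (hGcont : ∀ i j, Continuous (G i j))
    (hGsym : ∀ i j p, G i j p = (G j i p)ᴴ)
    (Θ₁ Θ₂ : D → Matrix (Fin 2) (Fin 2) ℂ)
    (hΘ₁cont : Continuous Θ₁) (hΘ₂cont : Continuous Θ₂)
    (hΘ₁herm : ∀ p, (Θ₁ p).IsHermitian) (hΘ₂herm : ∀ p, (Θ₂ p).IsHermitian)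
    (hΘ₁det : ∀ p, (Θ₁ p).det.re < 0) (hΘ₂det : ∀ p, (Θ₂ p).det.re < 0)
    (htwo : ∀ p : D, ∃ α₁ β₁ α₂ β₂ : ℂ, ¬(α₁ = 0 ∧ β₁ = 0) ∧ ¬(α₂ = 0 ∧ β₂ = 0) ∧
      (∀ c : ℂ, ¬(α₂ = c * α₁ ∧ β₂ = c * β₁)) ∧
      hermPairVal (Θ₁ p) α₁ β₁ = 0 ∧ 0 ≤ (hermPairVal (Θ₂ p) α₁ β₁).re ∧
      hermPairVal (Θ₁ p) α₂ β₂ = 0 ∧ 0 ≤ (hermPairVal (Θ₂ p) α₂ β₂).re)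
    (hdims : (m = 1 ∧ n < nz) ∨
      (1 < m ∧ nz = n + 1 ∧ ∀ p : D, ∀ α β : ℂ, ¬(α = 0 ∧ β = 0) →
        hermPairVal (Θ₁ p) α β = 0 → 0 ≤ (hermPairVal (Θ₂ p) α β).re →
        (α • N p - β • M p).rank = n)) :
    (∀ p : D, ∀ α β : ℂ, ¬(α = 0 ∧ β = 0) →
        hermPairVal (Θ₁ p) α β = 0 → 0 ≤ (hermPairVal (Θ₂ p) α β).re →
        ∀ z : Fin nz → ℂ, z ≠ 0 → (α • N p - β • M p) *ᵥ z = 0 →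
          (Matrix.of fun i j : Fin m => star z ⬝ᵥ (G i j p) *ᵥ z).PosDef)
      ↔
    (∃ H₁ H₂ : C(D, Matrix (Fin m × Fin n) (Fin m × Fin n) ℂ),
        ∀ p : D, (H₁ p).IsHermitian ∧ (H₂ p).IsHermitian ∧ (H₂ p).PosDef ∧
        ((Matrix.of fun q r : Fin m × Fin nz => G q.1 r.1 p q.2 r.2) -
          (lyapAdj (idKron m (M p)) (idKron m (N p)) (Θ₁ p) (H₁ p) +
           lyapAdj (idKron m (M p)) (idKron m (N p)) (Θ₂ p) (H₂ p))).PosDef) := by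
  constructor
  · intro hpos
    have hGc : Continuous fun p => blockMat fun i j => G i j p :=
      continuous_matrix fun q r => (hGcont q.1 r.1).matrix_elem q.2 r.2
    obtain ⟨H₁, H₂, hH⟩ := exists_continuous_lmi_solution hMcont hNcont hGc hΘ₁cont hΘ₂cont
      fun p => exists_lmi_of_formMat_posDef (hΘ₁herm p) (hΘ₂herm p) (hΘ₁det p) (htwo p)
        (fun i j => hGsym i j p)
        (fun α β h0 hΓ hΩ => hdims.imp (fun h => h.1) fun h => ⟨h.2.1, h.2.2 p α β h0 hΓ hΩ⟩)
        (hpos p)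
    refine ⟨H₁, H₂, fun p => ?_⟩
    obtain ⟨h1, h2, h3, h4⟩ := hH p
    exact ⟨h1, h2, h3.posDef h2, h4.posDef <| (blockMat_isHermitian fun i j => hGsym i j p).sub <|
      (lyapAdj_isHermitian _ _ (hΘ₁herm p) h1).add (lyapAdj_isHermitian _ _ (hΘ₂herm p) h2)⟩
  · rintro ⟨H₁, H₂, hH⟩ p α β h0 hΓ hΩ z hz0 hz
    obtain ⟨-, -, h3, h4⟩ := hH p
    exact formMat_posDef_of_lmi (hΘ₂herm p) (fun i j => hGsym i j p) h3 h4 h0 hΓ hΩ hz0 hz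
end

section
/- For all real numbers x and y, x⁴y² + x²y⁴ − 3x²y² + 1 + 10⁻¹¹ > 0. -/
/-- The Motzkin polynomial is nonnegative on `ℝ²`. -/
theorem motzkin_nonneg (x y : ℝ) :
    0 ≤ x ^ 4 * y ^ 2 + x ^ 2 * y ^ 4 - 3 * x ^ 2 * y ^ 2 + 1 := by
  have key : x ^ 4 * y ^ 2 + x ^ 2 * y ^ 4 - 3 * x ^ 2 * y ^ 2 + 1 =
      (|x| * |y|) ^ 2 * (|x| - |y|) ^ 2 +
        (|x| * |y| - 1) ^ 2 * (2 * (|x| * |y|) + 1) := by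
    rw [← Even.pow_abs (by decide : Even 4) x, ← Even.pow_abs (by decide : Even 4) y,
      ← sq_abs x, ← sq_abs y]
    ring
  rw [key]
  positivity

/-- The Motzkin polynomial `x⁴y² + x²y⁴ − 3x²y² + 1` shifted by `ε = 10⁻¹¹` is strictly
positive on `ℝ²` (even though it is not a sum of squares of polynomials). -/
theorem motzkin_shifted_pos (x y : ℝ) :
    x ^ 4 * y ^ 2 + x ^ 2 * y ^ 4 - 3 * x ^ 2 * y ^ 2 + 1 + 10 ^ (-11 : ℤ) > 0 := by
  have h : (0 : ℝ) < 10 ^ (-11 : ℤ) := by positivity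
  exact add_pos_of_nonneg_of_pos (motzkin_nonneg x y) h
end
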